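/- arXiv:2604.20815 — 3 statements merged into one kernel-verified Lean document; each statement's English description precedes it below -/
import Mathlib

section
/- Let r ≥ 2 be an integer. There exists a constant Λ_r > 0 (depending only on r) such that for every integer d ≥ 1, every integer t ≥ 2, every non-2-coherent r-direction-vector F in ℝ^d, and every F-family (B_1, …, B_r) with |B_j| = n_j for j = 1, …, r whose intersection hypergraph H is K_{t,…,t}^{(r)}-free, the number of hyperedges of H is at most Λ_r · g_t(n_1, …, n_r). -/
open Set

/-- The axis-parallel box in `ℝ^d` with corner functions `lo` and `hi`. -/
def boxSet {d : ℕ} (lo hi : Fin d → ℝ) : Set (Fin d → ℝ) :=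
  {x | ∀ i, x i ∈ Set.Icc (lo i) (hi i)}

/-- `S` is an axis-parallel box in `ℝ^d` with direction set `F`
(degenerate coordinates allowed). -/
def IsBoxDir {d : ℕ} (S : Set (Fin d → ℝ)) (F : Set (Fin d)) : Prop :=
  ∃ lo hi : Fin d → ℝ, (∀ i, lo i ≤ hi i) ∧ S = boxSet lo hi ∧ F = {i | lo i < hi i}

/-- `S` is an axis-parallel box in `ℝ^d` (with some direction set). -/
def IsBox {d : ℕ} (S : Set (Fin d → ℝ)) : Prop :=
  ∃ lo hi : Fin d → ℝ, (∀ i, lo i ≤ hi i) ∧ S = boxSet lo hi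

/-- The number of hyperedges of the `r`-partite `r`-uniform intersection hypergraph of
the indexed families `B j : Fin (n j) → Set α`. -/
noncomputable def hyperedgeCount {α : Type} {r : ℕ} (n : Fin r → ℕ)
    (B : ∀ j : Fin r, Fin (n j) → Set α) : ℕ :=
  Nat.card {f : ∀ j : Fin r, Fin (n j) // (⋂ j, B j (f j)).Nonempty}

/-- The intersection hypergraph of the families `B j` is `K_{t,…,t}`-free:
there are no `t`-element subfamilies `S j ⊆ B j` all of whose transversal tuples
have a common point. -/
def KFree {α : Type} {r : ℕ} (t : ℕ) (n : Fin r → ℕ)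
    (B : ∀ j : Fin r, Fin (n j) → Set α) : Prop :=
  ¬ ∃ S : ∀ j : Fin r, Finset (Fin (n j)),
      (∀ j, (S j).card = t) ∧
      ∀ f : ∀ j : Fin r, Fin (n j), (∀ j, f j ∈ S j) → (⋂ j, B j (f j)).Nonempty

/-- `g_t(n_1, …, n_r) = t · n_1 ⋯ n_r · (1/n_1 + ⋯ + 1/n_r)`. -/
noncomputable def gZ {r : ℕ} (t : ℕ) (n : Fin r → ℕ) : ℝ :=
  (t : ℝ) * (∏ j, (n j : ℝ)) * (∑ j, 1 / (n j : ℝ))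

/-- `F` is a 2-coherent direction-vector: for some `k`, the common directions of all
families other than `k` number at least two. -/
def TwoCoherent {d r : ℕ} (F : Fin r → Set (Fin d)) : Prop :=
  ∃ k : Fin r, 2 ≤ Set.ncard {i : Fin d | ∀ j : Fin r, j ≠ k → i ∈ F j}

namespace ZB

set_option linter.unusedSectionVars false

/-- edges of the combinatorial model -/
def Edge {ι : Type} {α : ι → Type} (C : ∀ j i, α j → Set (α i)) (f : ∀ j, α j) : Prop :=
  ∀ j i, j ≠ i → f i ∈ C j i (f j)

/-- product of the sizes of all families except `k` -/
def prodE {ι : Type} [Fintype ι] [DecidableEq ι] {α : ι → Type} (X : ∀ j, Finset (α j)) (k : ι) : ℕ := ∏ j ∈ Finset.univ.erase k, (X j).card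

section Model

variable {ι : Type} [Fintype ι] [DecidableEq ι] {α : ι → Type} [∀ j, LinearOrder (α j)]

/-- bounded number of elements of small co-rank -/
lemma rank_card {β : Type} [LinearOrder β] (W : Finset β) (M : ℕ) :
    (W.filter (fun w => (W.filter (fun a => w < a)).card < M)).card ≤ M := by
  set V := W.filter (fun w => (W.filter (fun a => w < a)).card < M) with hV
  rcases V.eq_empty_or_nonempty with h | h
  · simp [h]
  · have hm := V.min'_mem h
    set w := V.min' h with hw
    have h1 : V.erase w ⊆ W.filter (fun a => w < a) := by
      intro a ha
      rw [Finset.mem_erase] at ha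
      have h2 : w ≤ a := V.min'_le a ha.2
      have h3 := Finset.mem_filter.1 (hV ▸ ha.2)
      exact Finset.mem_filter.2 ⟨h3.1, lt_of_le_of_ne h2 (Ne.symm ha.1)⟩
    have h2 := Finset.card_le_card h1
    have h3 := (Finset.mem_filter.1 (hV ▸ hm)).2
    have h4 := Finset.card_erase_add_one hm
    omega

/-- lowest `N` elements -/
lemma low_exists {β : Type} [LinearOrder β] (U : Finset β) (N : ℕ) (h : N ≤ U.card) :
    ∃ V ⊆ U, V.card = N ∧ ∀ b ∈ V, ∀ b' ∈ U, b' ≤ b → b' ∈ V := by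
  induction N with
  | zero => exact ⟨∅, by simp, by simp, by simp⟩
  | succ N ih =>
    obtain ⟨V, hVU, hVc, hV⟩ := ih (by omega)
    have hne : (U \ V).Nonempty := by
      rw [← Finset.card_pos]
      have := Finset.card_sdiff_add_card_eq_card hVU
      omega
    have hm := (U \ V).min'_mem hne
    set w := (U \ V).min' hne
    rw [Finset.mem_sdiff] at hm
    refine ⟨insert w V, ?_, ?_, ?_⟩
    · exact Finset.insert_subset hm.1 hVU
    · rw [Finset.card_insert_of_notMem hm.2, hVc]
    · intro b hb b' hb' hle
      by_cases hb'V : b' ∈ V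
      · exact Finset.mem_insert_of_mem hb'V
      · rcases Finset.mem_insert.1 hb with rfl | hbV
        · have : w ≤ b' := (U \ V).min'_le b' (Finset.mem_sdiff.2 ⟨hb', hb'V⟩)
          rw [le_antisymm hle this]
          exact Finset.mem_insert_self _ _
        · exfalso
          have hin := hV b hbV b' hb' hle
          contradiction

/-- `N`-th successor -/
lemma nth_exists {β : Type} [LinearOrder β] (L : Finset β) (c : β) (N : ℕ) (hN : 0 < N)
    (h : N ≤ (L.filter (fun a => c < a)).card) :
    ∃ s ∈ L, c < s ∧ (L.filter (fun a => c < a ∧ a ≤ s)).card = N := by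
  obtain ⟨V, hVU, hVc, hV⟩ := low_exists _ N h
  have hne : V.Nonempty := by rw [← Finset.card_pos]; omega
  have hm := V.max'_mem hne
  have hs := Finset.mem_filter.1 (hVU hm)
  refine ⟨V.max' hne, hs.1, hs.2, ?_⟩
  rw [← hVc]
  congr 1
  ext a
  simp only [Finset.mem_filter]
  constructor
  · rintro ⟨h1, h2, h3⟩
    exact hV _ hm a (Finset.mem_filter.2 ⟨h1, h2⟩) h3
  · intro ha
    have := Finset.mem_filter.1 (hVU ha)
    have hmx := V.le_max' a ha
    exact ⟨this.1, this.2, hmx⟩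

open Classical in
/-- elements of `X k` which complete `f` (off `k`) to an edge -/
noncomputable def Line (X : ∀ j, Finset (α j)) (C : ∀ j i, α j → Set (α i)) (k : ι)
    (f : ∀ j, α j) : Finset (α k) :=
  (X k).filter (fun a => Edge C (Function.update f k a))

open Classical in
/-- section elements below `y` and over `x` -/
noncomputable def WW (X : ∀ j, Finset (α j)) (C : ∀ j i, α j → Set (α i)) (k i : ι)
    (x : α k) (y : α i) (h : ∀ j, α j) : Finset (α i) :=
  (X i).filter (fun b => b ≤ y ∧ x ∈ C i k b ∧
    ∀ j, j ≠ i → j ≠ k → h j ∈ C i j b ∧ b ∈ C j i (h j))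

lemma card_slice (X : ∀ j, Finset (α j)) (k : ι) (x : α k) :
    (Fintype.piFinset (Function.update X k {x})).card = prodE X k := by
  rw [Fintype.card_piFinset, prodE, ← Finset.mul_prod_erase _ _ (Finset.mem_univ k)]
  simp only [Function.update_self, Finset.card_singleton, one_mul]
  apply Finset.prod_congr rfl
  intro j hj
  rw [Function.update_of_ne (Finset.ne_of_mem_erase hj)]

lemma update_mem_slice (X : ∀ j, Finset (α j)) (k : ι) (x : α k) (f : ∀ j, α j)
    (hf : ∀ j, j ≠ k → f j ∈ X j) :
    Function.update f k x ∈ Fintype.piFinset (Function.update X k {x}) := by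
  rw [Fintype.mem_piFinset]
  intro j
  by_cases h : j = k
  · subst h; simp
  · simp [Function.update_of_ne h, hf j h]

/-- The line counting lemma. -/
lemma last_count (X : ∀ j, Finset (α j)) (C : ∀ j i, α j → Set (α i)) (k : ι) (N : ℕ)
    (x0 : α k) (B : Finset (∀ j, α j)) (hX : ∀ f ∈ B, ∀ j, f j ∈ X j)
    (hE : ∀ f ∈ B, Edge C f)
    (hB : ∀ f ∈ B, ((Line X C k f).filter (fun a => f k < a)).card < N) :
    B.card ≤ N * prodE X k := by
  classical
  rw [← card_slice X k x0]
  apply Finset.card_le_mul_card_image_of_maps_to (f := fun f => Function.update f k x0)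
  · intro f hf
    exact update_mem_slice X k x0 f (fun j _ => hX f hf j)
  · intro h _
    refine le_trans ?_ (rank_card (Line X C k h) N)
    apply Finset.card_le_card_of_injOn (fun f => f k)
    · intro f hf
      simp only [Finset.coe_filter, Set.mem_ofPred_eq] at hf
      have hl : Line X C k h = Line X C k f := by
        rw [← hf.2]; simp [Line]
      simp only [Finset.coe_filter, Set.mem_ofPred_eq]
      rw [hl]
      refine ⟨?_, hB f hf.1⟩
      simp only [Line, Finset.mem_filter, Function.update_eq_self]
      exact ⟨hX f hf.1 k, hE f hf.1⟩
    · intro f hf g hg hfg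
      simp only [Finset.coe_filter, Set.mem_ofPred_eq] at hf hg
      have := hf.2.trans hg.2.symm
      ext j
      by_cases hj : j = k
      · subst hj; exact hfg
      · have h2 := congrFun this j
        simpa [Function.update_of_ne hj] using h2

/-- charging relation -/
def Rel (X : ∀ j, Finset (α j)) (C : ∀ j i, α j → Set (α i)) (k i : ι) (M N : ℕ)
    (xx : (∀ j, α j) → α k) (yy : (∀ j, α j) → α i) (f h : ∀ j, α j) : Prop :=
  (∀ j, j ≠ k → j ≠ i → f j = h j) ∧
  f i ∈ WW X C k i (xx h) (yy h) h ∧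
  ((WW X C k i (xx h) (yy h) h).filter (fun b => f i < b)).card < M ∧
  f k ∈ Line X C k f ∧ f k ≤ xx h ∧
  ((Line X C k f).filter (fun a => f k < a ∧ a ≤ xx h)).card < N

open Classical in
lemma rel_fiber (X : ∀ j, Finset (α j)) (C : ∀ j i, α j → Set (α i)) (k i : ι) (hki : k ≠ i)
    (M N : ℕ) (xx : (∀ j, α j) → α k) (yy : (∀ j, α j) → α i) (B : Finset (∀ j, α j))
    (h : ∀ j, α j) :
    (B.filter (fun f => Rel X C k i M N xx yy f h)).card ≤ N * M := by
  set W := WW X C k i (xx h) (yy h) h with hW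
  refine le_trans ?_ (Nat.mul_le_mul_left N (rank_card W M))
  apply Finset.card_le_mul_card_image_of_maps_to (f := fun f => f i)
  · intro f hf
    obtain ⟨_, h1, h2, h3, h4, _⟩ := Finset.mem_filter.1 hf
    exact Finset.mem_filter.2 ⟨h2, h3⟩
  · intro c _
    refine le_trans ?_ (rank_card ((Line X C k (Function.update h i c)).filter
      (fun a => a ≤ xx h)) N)
    have key : ∀ f ∈ (B.filter (fun f => Rel X C k i M N xx yy f h)).filter (fun f => f i = c),
        ∀ a, Function.update f k a = Function.update (Function.update h i c) k a := by
      intro f hf a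
      obtain ⟨hf, hc⟩ := Finset.mem_filter.1 hf
      obtain ⟨_, h1, -⟩ := Finset.mem_filter.1 hf
      ext j
      by_cases hj : j = k
      · subst hj; simp
      · rw [Function.update_of_ne hj, Function.update_of_ne hj]
        by_cases hji : j = i
        · subst hji; simp [hc]
        · rw [Function.update_of_ne hji]; exact h1 j hj hji
    apply Finset.card_le_card_of_injOn (fun f => f k)
    · intro f hf
      have hk := key f hf
      have hl : Line X C k (Function.update h i c) = Line X C k f := by
        simp only [Line, hk]
      obtain ⟨hf, hc⟩ := Finset.mem_filter.1 (Finset.mem_coe.1 hf)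
      obtain ⟨_, h1, h2, h3, h4, h5, h6⟩ := Finset.mem_filter.1 hf
      rw [hl]
      simp only [Finset.coe_filter, Set.mem_ofPred_eq, Finset.mem_filter]
      refine ⟨⟨h4, h5⟩, ?_⟩
      rw [Finset.filter_filter]
      simpa [and_comm] using h6
    · intro f hf g hg hfg
      have h1 := key f hf (f k)
      have h2 := key g hg (f k)
      have h3 : g k = f k := hfg.symm
      rw [Function.update_eq_self] at h1
      rw [← h3, Function.update_eq_self, h3] at h2
      rw [h1, h2]

lemma charge (X : ∀ j, Finset (α j)) (C : ∀ j i, α j → Set (α i)) (k i m : ι) (hki : k ≠ i)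
    (M N T : ℕ) (xx : (∀ j, α j) → α k) (yy : (∀ j, α j) → α i) (B : Finset (∀ j, α j))
    (x0 : α m)
    (hB : ∀ f ∈ B, ∃ S : Finset (∀ j, α j), T ≤ S.card ∧ ∀ h ∈ S,
      h ∈ Fintype.piFinset (Function.update X m {x0}) ∧ Rel X C k i M N xx yy f h) :
    B.card * T ≤ prodE X m * (N * M) := by
  classical
  rw [← card_slice X m x0]
  apply Finset.card_mul_le_card_mul (Rel X C k i M N xx yy)
  · intro f hf
    obtain ⟨S, hS, hS2⟩ := hB f hf
    refine hS.trans (Finset.card_le_card ?_)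
    intro h hh
    exact Finset.mem_filter.2 (hS2 h hh)
  · intro h _
    exact rel_fiber X C k i hki M N xx yy B h

/-- `s` bounds the box of the next `N` elements in every direction. -/
def Good (X : ∀ j, Finset (α j)) (C : ∀ j i, α j → Set (α i)) (N : ℕ) (f s : ∀ j, α j) : Prop :=
  (∀ j, f j ∈ X j) ∧ Edge C f ∧ ∀ k, s k ∈ Line X C k f ∧ f k < s k ∧
    ((Line X C k f).filter (fun a => f k < a ∧ a ≤ s k)).card = N

open Classical in
/-- elements starting inside the box -/
noncomputable def Evt (X : ∀ j, Finset (α j)) (C : ∀ j i, α j → Set (α i)) (k i : ι)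
    (f s : ∀ j, α j) : Finset (α i) :=
  (X i).filter (fun b => f i < b ∧ b ≤ s i ∧
    (∀ j, j ≠ i → j ≠ k → f j ∈ C i j b ∧ b ∈ C j i (f j)) ∧ f k ∉ C i k b ∧
    ∃ x ∈ X k, x ∈ C i k b ∧ x ≤ s k ∧ f k < x)

lemma line_mem {X : ∀ j, Finset (α j)} {C : ∀ j i, α j → Set (α i)} {k i : ι} (hki : k ≠ i)
    {f : ∀ j, α j} {a : α k} (ha : a ∈ Line X C k f) :
    a ∈ X k ∧ a ∈ C i k (f i) ∧ f i ∈ C k i a := by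
  simp only [Line, Finset.mem_filter] at ha
  refine ⟨ha.1, ?_, ?_⟩
  · have := ha.2 i k hki.symm
    simpa [Function.update_of_ne hki.symm] using this
  · have := ha.2 k i hki
    simpa [Function.update_of_ne hki.symm] using this

lemma mem_line_of {X : ∀ j, Finset (α j)} {C : ∀ j i, α j → Set (α i)} {i : ι}
    {f : ∀ j, α j} (hE : Edge C f) {b : α i} (hb : b ∈ X i)
    (h : ∀ j, j ≠ i → f j ∈ C i j b ∧ b ∈ C j i (f j)) : b ∈ Line X C i f := by
  simp only [Line, Finset.mem_filter]
  refine ⟨hb, ?_⟩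
  intro j l hjl
  by_cases hj : j = i
  · subst hj
    rw [Function.update_self, Function.update_of_ne hjl.symm]
    exact (h l hjl.symm).1
  · rw [Function.update_of_ne hj]
    by_cases hl : l = i
    · subst hl
      rw [Function.update_self]
      exact (h j hj).2
    · rw [Function.update_of_ne hl]
      exact hE j l hjl

lemma good_span {X : ∀ j, Finset (α j)} {C : ∀ j i, α j → Set (α i)}
    (hC : ∀ j i b, (C j i b).OrdConnected) {N : ℕ} {f s : ∀ j, α j} (hg : Good X C N f s)
    {k i : ι} (hki : k ≠ i) {a : α k} (h1 : f k ≤ a) (h2 : a ≤ s k) : a ∈ C i k (f i) := by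
  have h3 := (line_mem hki (hg.2.2 k).1).2.1
  have h4 := hg.2.1 i k hki.symm
  exact (hC i k (f i)).out h4 h3 ⟨h1, h2⟩

lemma WW_bound {X : ∀ j, Finset (α j)} {C : ∀ j i, α j → Set (α i)}
    (hC : ∀ j i b, (C j i b).OrdConnected) {N : ℕ} {f s : ∀ j, α j} (hg : Good X C N f s)
    {k i : ι} (hki : k ≠ i) {x : α k} {y : α i} {h : ∀ j, α j} (hx : x ∈ X k)
    (hfx : f k ≤ x) (hxs : x ≤ s k) (hys : y ≤ s i)
    (hh : ∀ j, j ≠ k → j ≠ i → f j = h j) :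
    ((WW X C k i x y h).filter (fun b => f i < b)).card ≤
      N + ((Evt X C k i f s).filter (fun b => b ≤ y)).card := by
  classical
  rw [← (hg.2.2 i).2.2]
  refine le_trans (Finset.card_le_card ?_) (Finset.card_union_le _ _)
  intro b hb
  simp only [WW, Finset.mem_filter] at hb
  obtain ⟨⟨hbX, hby, hxb, hact⟩, hfb⟩ := hb
  have hact' : ∀ j, j ≠ i → j ≠ k → f j ∈ C i j b ∧ b ∈ C j i (f j) := by
    intro j hj hjk
    rw [hh j hjk hj]
    exact hact j hj hjk
  rw [Finset.mem_union]
  by_cases hc : f k ∈ C i k b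
  · left
    refine Finset.mem_filter.2 ⟨mem_line_of hg.2.1 hbX ?_, hfb, hby.trans hys⟩
    intro j hj
    by_cases hjk : j = k
    · subst hjk
      exact ⟨hc, good_span hC hg hki.symm hfb.le (hby.trans hys)⟩
    · exact hact' j hj hjk
  · right
    refine Finset.mem_filter.2 ⟨Finset.mem_filter.2 ⟨hbX, hfb, hby.trans hys, hact', hc,
      x, hx, hxb, hxs, ?_⟩, hby⟩
    exact lt_of_le_of_ne hfx (fun h => hc (h ▸ hxb))

lemma good_rel {X : ∀ j, Finset (α j)} {C : ∀ j i, α j → Set (α i)}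
    (hC : ∀ j i b, (C j i b).OrdConnected) {N T : ℕ} {f s : ∀ j, α j} (hg : Good X C N f s)
    {k i : ι} (hki : k ≠ i) {xx : (∀ j, α j) → α k} {yy : (∀ j, α j) → α i}
    {h : ∀ j, α j} (hx : xx h ∈ X k)
    (hfx : f k ≤ xx h) (hxs : xx h ≤ s k) (hfy : f i ≤ yy h) (hys : yy h ≤ s i)
    (hh : ∀ j, j ≠ k → j ≠ i → f j = h j)
    (hT : ((Evt X C k i f s).filter (fun b => b ≤ yy h)).card ≤ T) :
    Rel X C k i (N + T + 1) (N + 1) xx yy f h := by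
  have hE := hg.2.1
  refine ⟨hh, ?_, ?_, ?_, hfx, ?_⟩
  · simp only [WW, Finset.mem_filter]
    refine ⟨hg.1 i, hfy, good_span hC hg hki hfx hxs, ?_⟩
    intro j hj hjk
    rw [← hh j hjk hj]
    exact ⟨hE i j hj.symm, hE j i hj⟩
  · have := WW_bound hC hg hki hx hfx hxs hys hh
    omega
  · exact mem_line_of hE (hg.1 k) (fun j hj => ⟨hE k j hj.symm, hE j k hj⟩)
  · rw [← (hg.2.2 k).2.2, Nat.lt_succ_iff]
    apply Finset.card_le_card
    intro a ha
    simp only [Finset.mem_filter] at ha ⊢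
    exact ⟨ha.1, ha.2.1, ha.2.2.trans hxs⟩

open Classical in
lemma type1 {X : ∀ j, Finset (α j)} {C : ∀ j i, α j → Set (α i)}
    (hC : ∀ j i b, (C j i b).OrdConnected) {N T : ℕ} (B : Finset (∀ j, α j))
    (s : (∀ j, α j) → ∀ j, α j) {k i : ι} (hki : k ≠ i) (x0 : ∀ j, α j)
    (hB : ∀ f ∈ B, Good X C N f (s f) ∧ (Evt X C k i f (s f)).card ≤ T ∧
      T ≤ ((Line X C k f).filter
        (fun a => (f k < a ∧ a ≤ s f k) ∧ s f i ∉ C k i a)).card) :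
    B.card * T ≤ prodE X i * ((N + 1) * (N + T + 1)) := by
  let uu : α k → α i := fun a =>
    if h : ((X i).filter (fun b => b ∈ C k i a)).Nonempty then
      ((X i).filter (fun b => b ∈ C k i a)).max' h else x0 i
  apply charge X C k i i hki (N + T + 1) (N + 1) T (fun h => h k) (fun h => uu (h k)) B (x0 i)
  intro f hf
  obtain ⟨hg, hev, hT⟩ := hB f hf
  refine ⟨((Line X C k f).filter
        (fun a => (f k < a ∧ a ≤ s f k) ∧ s f i ∉ C k i a)).image
        (fun a => Function.update (Function.update f k a) i (x0 i)), ?_, ?_⟩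
  · rw [Finset.card_image_of_injective]
    · exact hT
    · intro a b hab
      have := congrFun hab k
      simpa [Function.update_of_ne hki] using this
  · intro h hh
    obtain ⟨a, ha, rfl⟩ := Finset.mem_image.1 hh
    obtain ⟨haL, ⟨hfa, has⟩, hsa⟩ := Finset.mem_filter.1 ha
    obtain ⟨haX, haC, hfC⟩ := line_mem hki haL
    constructor
    · apply update_mem_slice
      intro j hj
      by_cases hjk : j = k
      · subst hjk; simpa using haX
      · rw [Function.update_of_ne hjk]; exact hg.1 j
    · have hhk : (Function.update (Function.update f k a) i (x0 i)) k = a := by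
        rw [Function.update_of_ne hki, Function.update_self]
      have hmem : f i ∈ (X i).filter (fun b => b ∈ C k i a) :=
        Finset.mem_filter.2 ⟨hg.1 i, hfC⟩
      have hne : ((X i).filter (fun b => b ∈ C k i a)).Nonempty := ⟨_, hmem⟩
      have huu : uu a = ((X i).filter (fun b => b ∈ C k i a)).max' hne := dif_pos hne
      have hfu : f i ≤ uu a := by rw [huu]; exact Finset.le_max' _ _ hmem
      have huC : uu a ∈ C k i a := by
        have := Finset.max'_mem _ hne
        rw [← huu] at this
        exact (Finset.mem_filter.1 this).2
      have hus : uu a ≤ s f i := by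
        by_contra hlt
        exact hsa ((hC k i a).out hfC huC ⟨(hg.2.2 i).2.1.le, (not_le.1 hlt).le⟩)
      apply good_rel hC hg hki
      · rw [hhk]; exact haX
      · rw [hhk]; exact hfa.le
      · rw [hhk]; exact has
      · rw [hhk]; exact hfu
      · rw [hhk]; exact hus
      · intro j hjk hji
        rw [Function.update_of_ne hji, Function.update_of_ne hjk]
      · exact (Finset.card_le_card (Finset.filter_subset _ _)).trans hev

open Classical in
lemma type2 {X : ∀ j, Finset (α j)} {C : ∀ j i, α j → Set (α i)}
    (hC : ∀ j i b, (C j i b).OrdConnected) {N T : ℕ} (B : Finset (∀ j, α j))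
    (s : (∀ j, α j) → ∀ j, α j) {k i : ι} (hki : k ≠ i) (x0 : ∀ j, α j)
    (hB : ∀ f ∈ B, Good X C N f (s f) ∧ T ≤ (Evt X C k i f (s f)).card) :
    B.card * T ≤ prodE X k * ((N + 1) * (N + T + 1)) := by
  let ll : α i → α k := fun b =>
    if h : ((X k).filter (fun a => a ∈ C i k b)).Nonempty then
      ((X k).filter (fun a => a ∈ C i k b)).min' h else x0 k
  apply charge X C k i k hki (N + T + 1) (N + 1) T (fun h => ll (h i)) (fun h => h i) B (x0 k)
  intro f hf
  obtain ⟨hg, hT⟩ := hB f hf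
  obtain ⟨V, hVU, hVc, hV⟩ := low_exists _ T hT
  refine ⟨V.image (fun b => Function.update (Function.update f i b) k (x0 k)), ?_, ?_⟩
  · rw [Finset.card_image_of_injective]
    · exact hVc.ge
    · intro a b hab
      have := congrFun hab i
      simpa [Function.update_of_ne hki.symm] using this
  · intro h hh
    obtain ⟨b, hb, rfl⟩ := Finset.mem_image.1 hh
    obtain ⟨hbX, hfb, hbs, hact, hfC, x, hxX, hxC, hxs, hfx⟩ := Finset.mem_filter.1 (hVU hb)
    constructor
    · apply update_mem_slice
      intro j hj
      by_cases hjk : j = i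
      · subst hjk; simpa using hbX
      · rw [Function.update_of_ne hjk]; exact hg.1 j
    · have hhk : (Function.update (Function.update f i b) k (x0 k)) i = b := by
        rw [Function.update_of_ne hki.symm, Function.update_self]
      have hmem : x ∈ (X k).filter (fun a => a ∈ C i k b) := Finset.mem_filter.2 ⟨hxX, hxC⟩
      have hne : ((X k).filter (fun a => a ∈ C i k b)).Nonempty := ⟨_, hmem⟩
      have huu : ll b = ((X k).filter (fun a => a ∈ C i k b)).min' hne := dif_pos hne
      have hlx : ll b ≤ x := by rw [huu]; exact Finset.min'_le _ _ hmem
      have hlm := Finset.min'_mem _ hne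
      rw [← huu] at hlm
      have hlm := Finset.mem_filter.1 hlm
      have hus : f k ≤ ll b := by
        by_contra hlt
        exact hfC ((hC i k b).out hlm.2 hxC ⟨(not_le.1 hlt).le, hfx.le⟩)
      apply good_rel hC hg hki
      · rw [hhk]; exact hlm.1
      · rw [hhk]; exact hus
      · rw [hhk]; exact hlx.trans hxs
      · rw [hhk]; exact hfb.le
      · rw [hhk]; exact hbs
      · intro j hjk hji
        rw [Function.update_of_ne hjk, Function.update_of_ne hji]
      · rw [hhk, ← hVc]
        apply Finset.card_le_card
        intro b' hb'
        obtain ⟨h1, h2⟩ := Finset.mem_filter.1 hb'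
        have hres := hV b hb b' h1 h2
        exact hres

/-- no complete `t`-subsystem inside `X` -/
def KF {ι : Type} {α : ι → Type} (t : ℕ) (X : ∀ j, Finset (α j)) (E : (∀ j, α j) → Prop) : Prop :=
  ¬ ∃ S : ∀ j, Finset (α j), (∀ j, S j ⊆ X j) ∧ (∀ j, (S j).card = t) ∧
    ∀ f : ∀ j, α j, (∀ j, f j ∈ S j) → E f

open Classical in
/-- If there are few bad events there is a complete subsystem. -/
lemma not_free {X : ∀ j, Finset (α j)} {C : ∀ j i, α j → Set (α i)}
    (hC : ∀ j i b, (C j i b).OrdConnected) {N t : ℕ} {f s : ∀ j, α j} (hg : Good X C N f s)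
    (hN : (Fintype.card ι + 1) * t ≤ N)
    (hbad : ∀ k i, k ≠ i → ((Line X C k f).filter
        (fun a => (f k < a ∧ a ≤ s k) ∧ s i ∉ C k i a)).card ≤ t) :
    ¬ KF t X (Edge C) := by
  intro hK
  apply hK
  let G : ∀ k, Finset (α k) := fun k => ((Line X C k f).filter
    (fun a => f k < a ∧ a ≤ s k)) \ (Finset.univ.erase k).biUnion (fun i =>
      (Line X C k f).filter (fun a => (f k < a ∧ a ≤ s k) ∧ s i ∉ C k i a))
  have hG : ∀ k, t ≤ (G k).card := by
    intro k
    have h1 : ((Finset.univ.erase k).biUnion (fun i =>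
      (Line X C k f).filter (fun a => (f k < a ∧ a ≤ s k) ∧ s i ∉ C k i a))).card ≤
        (Finset.univ.erase k).card * t := by
      apply Finset.card_biUnion_le_card_mul
      intro i hi
      exact hbad k i (Finset.ne_of_mem_erase hi).symm
    have h2 : (Finset.univ.erase k).card ≤ Fintype.card ι := Finset.card_le_univ _
    have h3 : (Finset.univ.erase k).card * t ≤ Fintype.card ι * t := Nat.mul_le_mul_right t h2
    have h4 := Finset.le_card_sdiff ((Finset.univ.erase k).biUnion (fun i =>
      (Line X C k f).filter (fun a => (f k < a ∧ a ≤ s k) ∧ s i ∉ C k i a)))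
      ((Line X C k f).filter (fun a => f k < a ∧ a ≤ s k))
    rw [(hg.2.2 k).2.2] at h4
    have : (Fintype.card ι + 1) * t = Fintype.card ι * t + t := by ring
    change t ≤ (_ \ _ : Finset _).card
    omega
  choose S hSG hSc using fun k => Finset.exists_subset_card_eq (hG k)
  have hmem : ∀ k, ∀ a ∈ S k, a ∈ Line X C k f ∧ (f k < a ∧ a ≤ s k) ∧
      ∀ i, k ≠ i → s i ∈ C k i a := by
    intro k a ha
    have := hSG k ha
    simp only [G, Finset.mem_sdiff, Finset.mem_filter, Finset.mem_biUnion, Finset.mem_erase,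
      Finset.mem_univ, and_true, not_exists, not_and] at this
    refine ⟨this.1.1, this.1.2, fun i hi => ?_⟩
    by_contra hc
    exact this.2 i hi.symm this.1.1 this.1.2 hc
  refine ⟨S, ?_, hSc, ?_⟩
  · intro k a ha
    exact (Finset.mem_filter.1 (hmem k a ha).1).1
  · intro g hgS j i hji
    obtain ⟨h1, h2, h3⟩ := hmem j _ (hgS j)
    obtain ⟨h4, h5, h6⟩ := hmem i _ (hgS i)
    exact (hC j i (g j)).out (line_mem hji h1).2.2 (h3 i hji) ⟨h5.1.le, h5.2⟩

open Classical in
/-- The bound in the combinatorial model. -/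
lemma model_bound (X : ∀ j, Finset (α j)) (C : ∀ j i, α j → Set (α i))
    (hC : ∀ j i b, (C j i b).OrdConnected) (t : ℕ) (ht : 1 ≤ t) (hK : KF t X (Edge C)) :
    ((Fintype.piFinset X).filter (Edge C)).card ≤
      ((Fintype.card ι + 1) + 2 * Fintype.card ι * ((Fintype.card ι + 2) * (Fintype.card ι + 3)))
        * (t * ∑ k, prodE X k) := by
  set r := Fintype.card ι with hr
  set N := (r + 1) * t with hN
  have hN0 : 0 < N := by positivity
  rcases (Fintype.piFinset X).eq_empty_or_nonempty with h0 | ⟨x0, hx0⟩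
  · simp [h0]
  set P := (Fintype.piFinset X).filter (Edge C) with hP
  have hPX : ∀ f ∈ P, ∀ j, f j ∈ X j := fun f hf =>
    Fintype.mem_piFinset.1 (Finset.mem_filter.1 hf).1
  have hPE : ∀ f ∈ P, Edge C f := fun f hf => (Finset.mem_filter.1 hf).2
  let Lst : ι → Finset (∀ j, α j) := fun k =>
    P.filter (fun f => ((Line X C k f).filter (fun a => f k < a)).card < N)
  have hex : ∀ f : ∀ j, α j, ∃ s : ∀ j, α j, f ∈ P → (∀ k, f ∉ Lst k) → Good X C N f s := by
    intro f
    by_cases hf : f ∈ P ∧ ∀ k, f ∉ Lst k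
    · have : ∀ k, ∃ s ∈ Line X C k f, f k < s ∧
          ((Line X C k f).filter (fun a => f k < a ∧ a ≤ s)).card = N := by
        intro k
        apply nth_exists _ _ _ hN0
        by_contra hlt
        exact hf.2 k (Finset.mem_filter.2 ⟨hf.1, not_le.1 hlt⟩)
      choose s hs using this
      exact ⟨s, fun _ _ => ⟨hPX f hf.1, hPE f hf.1, hs⟩⟩
    · exact ⟨x0, fun h1 h2 => absurd ⟨h1, h2⟩ hf⟩
  choose s hs using hex
  let Q := P.filter (fun f => ∀ k, f ∉ Lst k)
  have hQ : ∀ f ∈ Q, Good X C N f (s f) := fun f hf =>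
    hs f (Finset.mem_filter.1 hf).1 (Finset.mem_filter.1 hf).2
  let B2 : ι → ι → Finset (∀ j, α j) := fun k i =>
    if k = i then ∅ else Q.filter (fun f => t ≤ (Evt X C k i f (s f)).card)
  let B1 : ι → ι → Finset (∀ j, α j) := fun i k =>
    if k = i then ∅ else Q.filter (fun f => (Evt X C k i f (s f)).card ≤ t ∧
      t ≤ ((Line X C k f).filter
        (fun a => (f k < a ∧ a ≤ s f k) ∧ s f i ∉ C k i a)).card)
  have hcover : P ⊆ Finset.univ.biUnion (fun k => Lst k ∪ (Finset.univ.biUnion (B2 k) ∪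
      Finset.univ.biUnion (B1 k))) := by
    intro f hf
    by_contra hn
    simp only [Finset.mem_biUnion, Finset.mem_univ, true_and, Finset.mem_union, not_exists,
      not_or] at hn
    have hfQ : f ∈ Q := Finset.mem_filter.2 ⟨hf, fun k => (hn k).1⟩
    refine not_free hC (t := t) (hQ f hfQ) le_rfl ?_ hK
    intro k i hki
    have h2 := (hn k).2.1 i
    have h1 := (hn i).2.2 k
    simp only [B1, B2, if_neg hki, Finset.mem_filter, hfQ, true_and, not_le, not_and] at h1 h2
    exact (h1 h2.le).le
  have hcanc : ∀ b p : ℕ, b * t ≤ p * ((N + 1) * (N + t + 1)) →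
      b ≤ (r + 2) * (r + 3) * t * p := by
    intro b p hb
    have h1 : N + 1 ≤ (r + 2) * t := by rw [hN]; nlinarith
    have h2 : N + t + 1 ≤ (r + 3) * t := by rw [hN]; nlinarith
    have h3 := Nat.mul_le_mul_left p (Nat.mul_le_mul h1 h2)
    have h4 : b * t ≤ ((r + 2) * (r + 3) * t * p) * t := by
      refine (hb.trans h3).trans (le_of_eq ?_)
      ring
    exact Nat.le_of_mul_le_mul_right h4 (by omega)
  have hLc : ∀ k, (Lst k).card ≤ N * prodE X k := by
    intro k
    apply last_count X C k N (x0 k)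
    · exact fun f hf => hPX f (Finset.mem_filter.1 hf).1
    · exact fun f hf => hPE f (Finset.mem_filter.1 hf).1
    · exact fun f hf => (Finset.mem_filter.1 hf).2
  have hB2c : ∀ k i, (B2 k i).card ≤ (r + 2) * (r + 3) * t * prodE X k := by
    intro k i
    by_cases hki : k = i
    · simp [B2, hki]
    · apply hcanc
      apply type2 hC _ s hki x0
      intro f hf
      simp only [B2, if_neg hki, Finset.mem_filter] at hf
      exact ⟨hQ f hf.1, hf.2⟩
  have hB1c : ∀ i k, (B1 i k).card ≤ (r + 2) * (r + 3) * t * prodE X i := by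
    intro i k
    by_cases hki : k = i
    · simp [B1, hki]
    · apply hcanc
      apply type1 hC _ s hki x0
      intro f hf
      simp only [B1, if_neg hki, Finset.mem_filter] at hf
      exact ⟨hQ f hf.1, hf.2.1, hf.2.2⟩
  have hbi : ∀ (b : ι → Finset (∀ j, α j)) (c : ℕ), (∀ i, (b i).card ≤ c) →
      (Finset.univ.biUnion b).card ≤ r * c := by
    intro b c hb
    have := Finset.card_biUnion_le_card_mul Finset.univ b c (fun i _ => hb i)
    simpa [hr] using this
  calc P.card ≤ _ := Finset.card_le_card hcover
    _ ≤ ∑ k, _ := Finset.card_biUnion_le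
    _ ≤ ∑ k, (N * prodE X k + (r * ((r + 2) * (r + 3) * t * prodE X k) +
          r * ((r + 2) * (r + 3) * t * prodE X k))) := by
        apply Finset.sum_le_sum
        intro k _
        refine (Finset.card_union_le _ _).trans (Nat.add_le_add (hLc k) ?_)
        exact (Finset.card_union_le _ _).trans (Nat.add_le_add (hbi _ _ (hB2c k)) (hbi _ _ (hB1c k)))
    _ = _ := by
        rw [Finset.mul_sum, Finset.mul_sum]
        apply Finset.sum_congr rfl
        intro k _
        rw [hN]; ring

end Model

section Reduction

variable {ι : Type} [Fintype ι] [DecidableEq ι] {β : ι → Type}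

open Classical in
/-- the desired bound, for all subsystems -/
def Bound (Λ t : ℕ) (E : (∀ j, β j) → Prop) : Prop :=
  ∀ X : ∀ j, Finset (β j), KF t X E →
    ((Fintype.piFinset X).filter E).card ≤ Λ * (t * ∑ k, prodE X k)

/-- constant of the model -/
def cst (r : ℕ) : ℕ := (r + 1) + 2 * r * ((r + 2) * (r + 3))

lemma KF.mono {t : ℕ} {X Y : ∀ j, Finset (β j)} {E E' : (∀ j, β j) → Prop} (h : KF t X E)
    (hXY : ∀ j, Y j ⊆ X j) (hE : ∀ f, (∀ j, f j ∈ Y j) → E' f → E f) : KF t Y E' := by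
  rintro ⟨S, h1, h2, h3⟩
  exact h ⟨S, fun j => (h1 j).trans (hXY j), h2,
    fun f hf => hE f (fun j => h1 j (hf j)) (h3 f hf)⟩

lemma bound_mono {Λ Λ' t : ℕ} {E : (∀ j, β j) → Prop} (h : Bound Λ t E) (hl : Λ ≤ Λ') :
    Bound Λ' t E := fun X hK => (h X hK).trans (Nat.mul_le_mul_right _ hl)

lemma bound_union {Λ t : ℕ} {E : (∀ j, β j) → Prop} (E' : ι → (∀ j, β j) → Prop)
    (h : ∀ k, Bound Λ t (E' k)) (h1 : ∀ k f, E' k f → E f) (h2 : ∀ f, E f → ∃ k, E' k f) :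
    Bound (Fintype.card ι * Λ) t E := by
  classical
  intro X hK
  have hsub : (Fintype.piFinset X).filter E ⊆
      Finset.univ.biUnion (fun k => (Fintype.piFinset X).filter (E' k)) := by
    intro f hf
    obtain ⟨hf1, hf2⟩ := Finset.mem_filter.1 hf
    obtain ⟨k, hk⟩ := h2 f hf2
    exact Finset.mem_biUnion.2 ⟨k, Finset.mem_univ _, Finset.mem_filter.2 ⟨hf1, hk⟩⟩
  have h3 := Finset.card_biUnion_le_card_mul Finset.univ
    (fun k => (Fintype.piFinset X).filter (E' k)) (Λ * (t * ∑ k, prodE X k))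
    (fun k _ => by
      have := h k X (hK.mono (fun _ => subset_rfl) (fun f _ => h1 k f))
      convert this)
  have h4 := (Finset.card_le_card hsub).trans h3
  rw [Finset.card_univ, ← mul_assoc] at h4
  convert h4

lemma bound_and {Λ t : ℕ} {E : (∀ j, β j) → Prop} (h : Bound Λ t E)
    (I : ∀ j, β j → Set ℝ) (p : ∀ j, β j → ℝ) {j1 j2 : ι} (hj : j1 ≠ j2)
    (h1 : ∀ b, I j1 b = {p j1 b}) (h2 : ∀ b, I j2 b = {p j2 b}) :
    Bound Λ t (fun f => E f ∧ ∃ x, ∀ j, x ∈ I j (f j)) := by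
  classical
  intro X hK
  let Y : ℝ → ∀ j, Finset (β j) := fun x j => (X j).filter (fun b => x ∈ I j b)
  let Q := (X j1).image (p j1)
  have hYX : ∀ x j, Y x j ⊆ X j := fun x j => Finset.filter_subset _ _
  have hsub : (Fintype.piFinset X).filter (fun f => E f ∧ ∃ x, ∀ j, x ∈ I j (f j)) ⊆
      Q.biUnion (fun x => (Fintype.piFinset (Y x)).filter E) := by
    intro f hf
    obtain ⟨hf1, hf2, x, hx⟩ := Finset.mem_filter.1 hf
    rw [Fintype.mem_piFinset] at hf1
    refine Finset.mem_biUnion.2 ⟨x, ?_, Finset.mem_filter.2 ⟨?_, hf2⟩⟩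
    · have := hx j1
      rw [h1] at this
      exact Finset.mem_image.2 ⟨f j1, hf1 j1, this.symm⟩
    · rw [Fintype.mem_piFinset]
      exact fun j => Finset.mem_filter.2 ⟨hf1 j, hx j⟩
  have hone : ∀ x, ((Fintype.piFinset (Y x)).filter E).card ≤
      Λ * (t * ∑ k, prodE (Y x) k) := by
    intro x
    have := h (Y x) (hK.mono (hYX x) (fun f hf hE =>
      ⟨hE, x, fun j => (Finset.mem_filter.1 (hf j)).2⟩))
    convert this
  have hfib : ∀ j, (∀ b, I j b = {p j b}) → ∑ x ∈ Q, (Y x j).card ≤ (X j).card := by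
    intro j hj
    rw [← Finset.card_biUnion]
    · apply Finset.card_le_card
      intro b hb
      obtain ⟨x, _, hx⟩ := Finset.mem_biUnion.1 hb
      exact hYX x j hx
    · intro x _ y _ hxy
      refine Finset.disjoint_left.2 ?_
      intro b hb hb'
      have e1 := (Finset.mem_filter.1 hb).2
      have e2 := (Finset.mem_filter.1 hb').2
      rw [hj] at e1 e2
      exact hxy (e1.trans e2.symm)
  have hsum : ∀ k, ∑ x ∈ Q, prodE (Y x) k ≤ prodE X k := by
    intro k
    obtain ⟨j, hjk, hjI⟩ : ∃ j, j ≠ k ∧ ∀ b, I j b = {p j b} := by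
      by_cases hk : j1 = k
      · exact ⟨j2, fun h => hj (hk.trans h.symm), h2⟩
      · exact ⟨j1, hk, h1⟩
    have hmem : j ∈ Finset.univ.erase k := Finset.mem_erase.2 ⟨hjk, Finset.mem_univ _⟩
    unfold prodE
    rw [← Finset.mul_prod_erase _ _ hmem]
    calc ∑ x ∈ Q, ∏ j ∈ Finset.univ.erase k, (Y x j).card
        ≤ ∑ x ∈ Q, (Y x j).card * ∏ j ∈ (Finset.univ.erase k).erase j, (X j).card := by
          apply Finset.sum_le_sum
          intro x _
          rw [← Finset.mul_prod_erase _ _ hmem]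
          apply Nat.mul_le_mul_left
          exact Finset.prod_le_prod' (fun i _ => Finset.card_le_card (hYX x i))
      _ ≤ _ := by
          rw [← Finset.sum_mul]
          exact Nat.mul_le_mul_right _ (hfib j hjI)
  have hfin : ((Fintype.piFinset X).filter (fun f => E f ∧ ∃ x, ∀ j, x ∈ I j (f j))).card ≤
      Λ * (t * ∑ k, prodE X k) := by
    calc _ ≤ _ := Finset.card_le_card hsub
      _ ≤ ∑ x ∈ Q, _ := Finset.card_biUnion_le
      _ ≤ ∑ x ∈ Q, Λ * (t * ∑ k, prodE (Y x) k) := Finset.sum_le_sum (fun x _ => hone x)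
      _ = Λ * (t * ∑ k, ∑ x ∈ Q, prodE (Y x) k) := by
          rw [← Finset.mul_sum, ← Finset.mul_sum, Finset.sum_comm]
      _ ≤ _ := Nat.mul_le_mul_left _ (Nat.mul_le_mul_left _
          (Finset.sum_le_sum (fun k _ => hsum k)))
  convert hfin

lemma bound_ands {δ : Type} {Λ t : ℕ} {E : (∀ j, β j) → Prop} (h : Bound Λ t E)
    (I : δ → ∀ j, β j → Set ℝ) (p : δ → ∀ j, β j → ℝ) (S : Finset δ)
    (hS : ∀ i ∈ S, ∃ j1 j2 : ι, j1 ≠ j2 ∧ (∀ b, I i j1 b = {p i j1 b}) ∧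
      ∀ b, I i j2 b = {p i j2 b}) :
    Bound Λ t (fun f => E f ∧ ∀ i ∈ S, ∃ x, ∀ j, x ∈ I i j (f j)) := by
  classical
  induction S using Finset.induction_on with
  | empty => simpa using h
  | insert i S hi ih =>
    have ih' := ih (fun i' hi' => hS i' (Finset.mem_insert_of_mem hi'))
    obtain ⟨j1, j2, hj, h1, h2⟩ := hS i (Finset.mem_insert_self _ _)
    have h3 := bound_and ih' (I i) (p i) hj h1 h2
    convert h3 using 2 with f
    simp only [Finset.mem_insert, forall_eq_or_imp]
    tauto

lemma model_real {r : ℕ} {n : Fin r → ℕ} (t : ℕ) (ht : 1 ≤ t) (p : ∀ k, Fin (n k) → ℝ)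
    (I : ∀ j k, Fin (n j) → Set ℝ) (hI : ∀ j k b, (I j k b).OrdConnected) :
    Bound (β := fun j => Fin (n j)) (cst r) t
      (Edge (α := fun j => Fin (n j)) (fun j k b => p k ⁻¹' (I j k b))) := by
  intro X hK
  let L : ∀ k : Fin r, LinearOrder (Fin (n k)) := fun k =>
    LinearOrder.lift' (fun b : Fin (n k) => toLex (p k b, b)) (by
      intro a b hab
      have := congrArg (fun z => (ofLex z).2) hab
      simpa using this)
  have hmono : ∀ k (a b : Fin (n k)), (L k).le a b → p k a ≤ p k b := by
    intro k a b hab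
    have h1 : toLex (p k a, a) ≤ toLex (p k b, b) := hab
    rw [Prod.Lex.le_iff] at h1
    rcases h1 with h1 | h1
    · exact h1.le
    · exact h1.1.le
  have := @model_bound (Fin r) _ _ (fun j => Fin (n j)) L X (fun j k b => p k ⁻¹' (I j k b))
    (by
      intro j k b
      refine @Set.OrdConnected.mk _ (L k).toPreorder _ ?_
      intro x hx y hy z hz
      exact (hI j k b).out hx hy ⟨hmono k _ _ hz.1, hmono k _ _ hz.2⟩) t ht hK
  simp only [Fintype.card_fin] at this
  exact this

end Reduction

end ZB

/-- upper bound `Λ_r · g_t(n)` for non-2-coherent direction-vectors. -/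
theorem stmt0 (r : ℕ) (hr : 2 ≤ r) :
    ∃ Λ : ℝ, 0 < Λ ∧
      ∀ (d : ℕ), 1 ≤ d → ∀ (t : ℕ), 2 ≤ t →
      ∀ (F : Fin r → Set (Fin d)), ¬ TwoCoherent F →
      ∀ (n : Fin r → ℕ), (∀ j, 0 < n j) →
      ∀ (B : ∀ j : Fin r, Fin (n j) → Set (Fin d → ℝ)),
        (∀ j k, IsBoxDir (B j k) (F j)) →
        KFree t n B →
        (hyperedgeCount n B : ℝ) ≤ Λ * gZ t n := by
  classical
  refine ⟨((r + 1) * ZB.cst r : ℕ), ?_, ?_⟩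
  · have : 0 < (r + 1) * ZB.cst r := by unfold ZB.cst; positivity
    exact_mod_cast this
  intro d _ t ht F hF n hn B hB hK
  choose lo hi hle hbox hdir using hB
  -- uniqueness of small coordinates
  have huniq : ∀ k i i', (∀ j, j ≠ k → i ∈ F j) → (∀ j, j ≠ k → i' ∈ F j) → i = i' := by
    intro k i i' h1 h2
    by_contra hne
    apply hF
    refine ⟨k, ?_⟩
    have hs : ({i, i'} : Set (Fin d)) ⊆ {i : Fin d | ∀ j : Fin r, j ≠ k → i ∈ F j} := by
      intro x hx
      rcases hx with rfl | rfl
      · exact h1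
      · exact h2
    rw [← Set.ncard_pair hne]
    exact Set.ncard_le_ncard hs (Set.toFinite _)
  have hdeg : ∀ j b i, i ∉ F j → hi j b i = lo j b i := by
    intro j b i hij
    rw [hdir j b] at hij
    exact le_antisymm (not_lt.1 hij) (hle j b i)
  let I : Fin d → ∀ j, Fin (n j) → Set ℝ := fun i j b => Set.Icc (lo j b i) (hi j b i)
  let cond : Fin d → (∀ j, Fin (n j)) → Prop := fun i f => ∃ x, ∀ j, x ∈ I i j (f j)
  have hIdeg : ∀ i j b, i ∉ F j → I i j b = {lo j b i} := by
    intro i j b hij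
    simp only [I, hdeg j b i hij, Set.Icc_self]
  have hE : ∀ f : ∀ j, Fin (n j), (⋂ j, B j (f j)).Nonempty ↔ ∀ i, cond i f := by
    intro f
    constructor
    · rintro ⟨x, hx⟩ i
      refine ⟨x i, fun j => ?_⟩
      have := Set.mem_iInter.1 hx j
      rw [hbox] at this
      exact this i
    · intro h
      choose x hx using h
      refine ⟨x, Set.mem_iInter.2 fun j => ?_⟩
      rw [hbox]
      exact fun i => hx i j
  let small : Fin d → Prop := fun i => ∃ k, ∀ j, j ≠ k → i ∈ F j
  have hbase : ZB.Bound (β := fun j => Fin (n j)) ((r + 1) * ZB.cst r) t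
      (fun f => ∀ i, small i → cond i f) := by
    by_cases hA : ∃ i0, ∀ j, i0 ∈ F j
    · obtain ⟨i0, hi0⟩ := hA
      have hsm : ∀ i, small i ↔ i = i0 := by
        intro i
        constructor
        · rintro ⟨k, hk⟩
          exact huniq k i i0 hk (fun j _ => hi0 j)
        · rintro rfl
          exact ⟨⟨0, by omega⟩, fun j _ => hi0 j⟩
      simp only [hsm, forall_eq]
      let J : Fin r → ∀ j k : Fin r, Fin (n j) → Set ℝ := fun m j k b =>
        {x | k = m → x ∈ I i0 j b}
      have hJ : ∀ m, ZB.Bound (β := fun j => Fin (n j)) (ZB.cst r) t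
          (ZB.Edge (α := fun j => Fin (n j))
            (fun j k b => (fun c : Fin (n k) => lo k c i0) ⁻¹' (J m j k b))) := by
        intro m
        apply ZB.model_real t (by omega) (fun k c => lo k c i0) (J m)
        intro j k b
        refine ⟨fun x hx y hy z hz hk => ?_⟩
        exact ⟨(hx hk).1.trans hz.1, hz.2.trans (hy hk).2⟩
      have h3 := ZB.bound_union (E := cond i0) _ hJ ?_ ?_
      · rw [Fintype.card_fin] at h3
        exact ZB.bound_mono h3 (Nat.mul_le_mul_right _ (by omega))
      · intro m f hf
        refine ⟨lo m (f m) i0, fun j => ?_⟩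
        by_cases hj : j = m
        · subst hj
          exact ⟨le_rfl, hle _ _ _⟩
        · exact hf j m hj rfl
      · rintro f ⟨x, hx⟩
        have : Nonempty (Fin r) := ⟨⟨0, by omega⟩⟩
        obtain ⟨m, hm⟩ := Finite.exists_max (fun k => lo k (f k) i0)
        refine ⟨m, ?_⟩
        intro j k hjk hk
        subst hk
        exact ⟨hm j, (hx k).1.trans (hx j).2⟩
    · let σ : Fin d → Fin r → Prop := fun i k => (∀ j, j ≠ k → i ∈ F j) ∧ i ∉ F k
      have hσ : ∀ i, small i → ∃ k, σ i k := by
        rintro i ⟨k, hk⟩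
        refine ⟨k, hk, fun hik => hA ⟨i, fun j => ?_⟩⟩
        by_cases hj : j = k
        · subst hj; exact hik
        · exact hk j hj
      have hp : ∀ k, ∃ p : Fin (n k) → ℝ, ∀ i, σ i k → ∀ c, p c = lo k c i := by
        intro k
        by_cases h : ∃ i, σ i k
        · obtain ⟨i, hi⟩ := h
          refine ⟨fun c => lo k c i, fun i' hi' c => ?_⟩
          rw [huniq k i i' hi.1 hi'.1]
        · exact ⟨fun _ => 0, fun i hi => absurd ⟨i, hi⟩ h⟩
      choose p hp using hp
      let J : ∀ j k : Fin r, Fin (n j) → Set ℝ := fun j k b => {x | ∀ i, σ i k → x ∈ I i j b}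
      have hJ := ZB.model_real t (by omega) p J (by
        intro j k b
        refine ⟨fun x hx y hy z hz i hi => ?_⟩
        exact ⟨(hx i hi).1.trans hz.1, hz.2.trans (hy i hi).2⟩)
      have heq : (fun f : ∀ j, Fin (n j) => ∀ i, small i → cond i f) =
          ZB.Edge (α := fun j => Fin (n j)) (fun j k b => p k ⁻¹' (J j k b)) := by
        funext f
        apply propext
        constructor
        · intro h j k hjk i hi
          obtain ⟨x, hx⟩ := h i ⟨k, hi.1⟩
          have h1 := hx k
          rw [hIdeg i k _ hi.2] at h1
          rw [hp k i hi, ← Set.mem_singleton_iff.1 h1]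
          exact hx j
        · intro h i hi
          obtain ⟨k, hk⟩ := hσ i hi
          refine ⟨p k (f k), fun j => ?_⟩
          by_cases hj : j = k
          · subst hj
            rw [hp j i hk]
            exact ⟨le_rfl, hle _ _ _⟩
          · exact h j k hj i hk
      rw [heq]
      exact ZB.bound_mono hJ (Nat.le_mul_of_pos_left _ (by omega))
  have hall := ZB.bound_ands hbase I (fun i j b => lo j b i)
    (Finset.univ.filter (fun i => ¬ small i)) (by
      intro i hi
      have hi := (Finset.mem_filter.1 hi).2
      simp only [small, not_exists, not_forall] at hi
      obtain ⟨j1, _, h1⟩ := hi ⟨0, by omega⟩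
      obtain ⟨j2, hj, h2⟩ := hi j1
      exact ⟨j1, j2, fun h => hj h.symm, fun b => hIdeg i j1 b h1, fun b => hIdeg i j2 b h2⟩)
  have hEe : (fun f : ∀ j, Fin (n j) => (∀ i, small i → cond i f) ∧
      ∀ i ∈ Finset.univ.filter (fun i => ¬ small i), ∃ x, ∀ j, x ∈ I i j (f j)) =
      (fun f => (⋂ j, B j (f j)).Nonempty) := by
    funext f
    apply propext
    rw [hE f]
    simp only [Finset.mem_filter, Finset.mem_univ, true_and]
    constructor
    · rintro ⟨h1, h2⟩ i
      by_cases hi : small i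
      · exact h1 i hi
      · exact h2 i hi
    · intro h
      exact ⟨fun i _ => h i, fun i _ => h i⟩
  rw [hEe] at hall
  have hfin := hall (fun j => Finset.univ) (by
    rintro ⟨S, _, h2, h3⟩
    exact hK ⟨S, h2, h3⟩)
  have hcount : hyperedgeCount n B = ((Fintype.piFinset (fun j : Fin r =>
      (Finset.univ : Finset (Fin (n j))))).filter (fun f => (⋂ j, B j (f j)).Nonempty)).card := by
    unfold hyperedgeCount
    rw [Nat.card_eq_fintype_card, Fintype.card_subtype, Fintype.piFinset_univ]
  have hg : gZ t n = ((t * ∑ k, ZB.prodE (fun j : Fin r =>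
      (Finset.univ : Finset (Fin (n j)))) k : ℕ) : ℝ) := by
    unfold gZ ZB.prodE
    push_cast
    rw [mul_assoc, Finset.mul_sum]
    congr 1
    apply Finset.sum_congr rfl
    intro k _
    rw [← Finset.mul_prod_erase _ _ (Finset.mem_univ k)]
    have : (n k : ℝ) ≠ 0 := by exact_mod_cast (hn k).ne'
    simp only [Finset.card_univ, Fintype.card_fin]
    field_simp
  rw [hcount, hg]
  exact_mod_cast hfin
end

section
/- Let d ≥ 2 and t ≥ 2 be integers. Every restricted family (B_1, …, B_d) in ℝ^d with |B_i| = n_i for i = 1, …, d whose intersection hypergraph H is K_{t,…,t}^{(d)}-free satisfies: the number of hyperedges of H is at most 27 · g_t(n_1, …, n_d). -/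
open Set

/-- A canonical family in `ℝ^d`: each box of `B i` has direction set `[d] \ {i}`. -/
def Canonical {d : ℕ} (n : Fin d → ℕ) (B : ∀ i : Fin d, Fin (n i) → Set (Fin d → ℝ)) : Prop :=
  ∀ i k, IsBoxDir (B i k) {j | j ≠ i}

/-- A separated family: canonical, and for each `i` no two boxes of `B i` have the same
`i`-th coordinate. -/
def Separated {d : ℕ} (n : Fin d → ℕ) (B : ∀ i : Fin d, Fin (n i) → Set (Fin d → ℝ)) : Prop :=
  Canonical n B ∧ ∀ i, ∀ k l : Fin (n i), k ≠ l →
    ∀ x ∈ B i k, ∀ y ∈ B i l, x i ≠ y i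

/-- A restricted family: separated, and any transversal of the first `d - 1` families
has a common point. -/
def Restricted {d : ℕ} (n : Fin d → ℕ) (B : ∀ i : Fin d, Fin (n i) → Set (Fin d → ℝ)) : Prop :=
  Separated n B ∧ ∀ f : ∀ i : Fin d, Fin (n i),
    (⋂ (i : Fin d) (_ : (i : ℕ) < d - 1), B i (f i)).Nonempty


namespace RB
section
open scoped Classical

/-- the `t` smallest elements of `C` -/
lemma first_t {α : Type} (t : ℕ) (q : α → ℝ) (C : Finset α) (h : t ≤ C.card) :
    ∃ T ⊆ C, T.card = t ∧ ∀ v ∈ T, ∀ u ∈ C, q u < q v → u ∈ T := by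
  induction t with
  | zero => exact ⟨∅, by simp⟩
  | succ k ih =>
    obtain ⟨T, hT, hc, hd⟩ := ih (by omega)
    have hne : (C \ T).Nonempty := by
      rw [← Finset.card_pos, Finset.card_sdiff_of_subset hT]; omega
    obtain ⟨x, hx, hmin⟩ := Finset.exists_min_image (C \ T) q hne
    rw [Finset.mem_sdiff] at hx
    refine ⟨insert x T, ?_, ?_, ?_⟩
    · intro y hy
      rcases Finset.mem_insert.1 hy with rfl | hy
      · exact hx.1
      · exact hT hy
    · rw [Finset.card_insert_of_notMem hx.2, hc]
    · intro v hv u hu huv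
      rcases Finset.mem_insert.1 hv with rfl | hv
      · by_contra hcon
        have : u ∈ C \ T := by
          rw [Finset.mem_sdiff]
          exact ⟨hu, fun h => hcon (Finset.mem_insert_of_mem h)⟩
        exact absurd (hmin u this) (not_le.2 huv)
      · exact Finset.mem_insert_of_mem (hd v hv u hu huv)

lemma first_t_sub {α : Type} (t : ℕ) (q : α → ℝ) (hq : Function.Injective q)
    (C : Finset α) (h : t ≤ C.card) :
    ∃ T ⊆ C, T.card = t ∧ ∀ N ⊆ C, (∀ u ∈ C, ∀ v ∈ N, q u < q v → u ∈ N) →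
      t ≤ N.card → T ⊆ N := by
  obtain ⟨T, hT, hc, hd⟩ := first_t t q C h
  refine ⟨T, hT, hc, ?_⟩
  intro N hN hNd hNt v hv
  by_contra hvN
  have hsub : N ⊆ T.erase v := by
    intro u hu
    have hne : u ≠ v := fun e => hvN (e ▸ hu)
    rw [Finset.mem_erase]
    refine ⟨hne, ?_⟩
    rcases lt_trichotomy (q u) (q v) with h1 | h1 | h1
    · exact hd v hv u (hN hu) h1
    · exact absurd (hq h1) hne
    · exact absurd (hNd v (hT hv) u hu h1) hvN
  have h1 := Finset.card_le_card hsub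
  have h2 := Finset.card_erase_lt_of_mem hv
  omega

/-- a set in which every element has few others ahead of it -/
lemma few {α : Type} (k : ℕ) (q : α → ℝ) (X : Finset α) (hk : 0 < k)
    (h : ∀ v ∈ X, (∀ u ∈ X, q v ≤ q u) → (X.erase v).card < k) : X.card ≤ k := by
  rcases X.eq_empty_or_nonempty with rfl | hne
  · simp
  obtain ⟨v, hv, hm⟩ := Finset.exists_min_image X q hne
  have := h v hv hm
  rw [Finset.card_erase_of_mem hv] at this
  omega

section planar
variable {V H : Type} [Fintype V] [Fintype H]

/-- planar adjacency -/
def Adj2 (p l r : V → ℝ) (lo hi z : H → ℝ) (v : V) (h : H) : Prop :=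
  lo h ≤ p v ∧ p v ≤ hi h ∧ l v ≤ z h ∧ z h ≤ r v

noncomputable def rightOf (p l r : V → ℝ) (lo hi z : H → ℝ) (b : V) (h : H) : Finset V :=
  Finset.univ.filter fun v => p b < p v ∧ Adj2 p l r lo hi z v h

noncomputable def insEv (p l r : V → ℝ) (t : ℕ) (b : V) : Finset V :=
  Finset.univ.filter fun v => p b < p v ∧ l b < l v ∧ l v ≤ r b ∧
    (Finset.univ.filter fun u => p b < p u ∧ p u < p v ∧ l u < l v ∧ l v ≤ r u).card < 3 * t

noncomputable def delEv (p l r : V → ℝ) (t : ℕ) (b : V) : Finset V :=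
  Finset.univ.filter fun v => p b < p v ∧ l b ≤ r v ∧ r v < r b ∧
    (Finset.univ.filter fun u => p b < p u ∧ p u < p v ∧ l u ≤ r v ∧ r v < r u).card < 3 * t

lemma swap_count (R : V → V → Prop) [∀ b v, Decidable (R b v)] (k : ℕ)
    (h : ∀ v, (Finset.univ.filter fun b => R b v).card ≤ k) :
    ∑ b, (Finset.univ.filter fun v => R b v).card ≤ k * Fintype.card V := by
  have : ∑ b, (Finset.univ.filter fun v => R b v).card
      = ∑ v, (Finset.univ.filter fun b => R b v).card := by
    simp only [Finset.card_filter]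
    exact Finset.sum_comm
  rw [this]
  calc _ ≤ ∑ _v : V, k := Finset.sum_le_sum fun v _ => h v
    _ = _ := by simp [mul_comm]

lemma ins_total (p l r : V → ℝ) (hp : Function.Injective p) (t : ℕ) (ht : 0 < t) :
    ∑ b, (insEv p l r t b).card ≤ 3 * t * Fintype.card V := by
  unfold insEv
  apply swap_count
  intro v
  apply few _ p _ (by omega)
  intro b hb hmin
  simp only [Finset.mem_filter, Finset.mem_univ, true_and] at hb
  refine lt_of_le_of_lt (Finset.card_le_card ?_) hb.2.2.2
  intro u hu
  rw [Finset.mem_erase] at hu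
  have h1 := hmin u hu.2
  have h2 := hu.2
  simp only [Finset.mem_filter, Finset.mem_univ, true_and] at h2 ⊢
  exact ⟨lt_of_le_of_ne h1 fun e => hu.1 (hp e.symm), h2.1, h2.2.1, h2.2.2.1⟩

lemma del_total (p l r : V → ℝ) (hp : Function.Injective p) (t : ℕ) (ht : 0 < t) :
    ∑ b, (delEv p l r t b).card ≤ 3 * t * Fintype.card V := by
  unfold delEv
  apply swap_count
  intro v
  apply few _ p _ (by omega)
  intro b hb hmin
  simp only [Finset.mem_filter, Finset.mem_univ, true_and] at hb
  refine lt_of_le_of_lt (Finset.card_le_card ?_) hb.2.2.2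
  intro u hu
  rw [Finset.mem_erase] at hu
  have h1 := hmin u hu.2
  have h2 := hu.2
  simp only [Finset.mem_filter, Finset.mem_univ, true_and] at h2 ⊢
  exact ⟨lt_of_le_of_ne h1 fun e => hu.1 (hp e.symm), h2.1, h2.2.1, h2.2.2.1⟩

lemma group (p l r : V → ℝ) (lo hi z : H → ℝ) (t : ℕ) (ht : 0 < t)
    (b : V) (T : Finset H) (h1 : H) (hh1 : h1 ∈ T) (hmin : ∀ h ∈ T, z h1 ≤ z h)
    (y : ℝ) (hy : ∀ h ∈ T, z h ≤ y) (hyr : y ≤ r b)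
    (hT : ∀ h ∈ T, Adj2 p l r lo hi z b h ∧ 3 * t ≤ (rightOf p l r lo hi z b h).card)
    (free : ¬ ∃ S : Finset V, S.card = t ∧ ∀ v ∈ S, ∀ h ∈ T, Adj2 p l r lo hi z v h) :
    t ≤ ((insEv p l r t b).filter fun v => z h1 < l v ∧ l v ≤ y).card
      + ((delEv p l r t b).filter fun v => z h1 ≤ r v ∧ r v < y).card := by
  obtain ⟨⟨hb1, hb2, hb3, hb4⟩, hC⟩ := hT h1 hh1
  obtain ⟨W, hWC, hWc, hWd⟩ := first_t (2 * t) p (rightOf p l r lo hi z b h1) (by omega)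
  have hWm : ∀ w ∈ W, p b < p w ∧ Adj2 p l r lo hi z w h1 := by
    intro w hw
    have := hWC hw
    simpa [rightOf] using this
  -- elements active at level z h1 between b and W lie in W
  have key : ∀ w ∈ W, ∀ u, p b < p u → p u < p w → l u ≤ z h1 → z h1 ≤ r u → u ∈ W := by
    intro w hw u h2 h3 h4 h5
    obtain ⟨_, a1, a2, a3, a4⟩ := hWm w hw
    refine hWd w hw u ?_ h3
    simp only [rightOf, Finset.mem_filter, Finset.mem_univ, true_and]
    exact ⟨h2, by linarith, by linarith, h4, h5⟩
  set V' : Finset V := Finset.univ.filter fun v => p b < p v ∧ (∃ w ∈ W, p v < p w) ∧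
    z h1 < l v ∧ l v ≤ y with hV'
  by_cases hcase : t ≤ V'.card
  · obtain ⟨U, hUV, hUc, hUd⟩ := first_t t l V' hcase
    refine le_trans ?_ (Nat.le_add_right _ _)
    rw [← hUc]
    apply Finset.card_le_card
    intro v hv
    have hv' := hUV hv
    simp only [hV', Finset.mem_filter, Finset.mem_univ, true_and] at hv'
    obtain ⟨v1, ⟨w, hw, v2⟩, v3, v4⟩ := hv'
    simp only [insEv, Finset.mem_filter, Finset.mem_univ, true_and]
    refine ⟨⟨v1, by linarith, by linarith, ?_⟩, v3, v4⟩
    have hs : (Finset.univ.filter fun u => p b < p u ∧ p u < p v ∧ l u < l v ∧ l v ≤ r u)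
        ⊆ W ∪ U.erase v := by
      intro u hu
      simp only [Finset.mem_filter, Finset.mem_univ, true_and] at hu
      obtain ⟨u1, u2, u3, u4⟩ := hu
      rw [Finset.mem_union]
      by_cases hlu : l u ≤ z h1
      · left
        exact key w hw u u1 (by linarith) hlu (by linarith)
      · right
        push Not at hlu
        rw [Finset.mem_erase]
        refine ⟨fun e => by subst e; exact lt_irrefl _ u2, ?_⟩
        refine hUd v hv u ?_ u3
        simp only [hV', Finset.mem_filter, Finset.mem_univ, true_and]
        exact ⟨u1, ⟨w, hw, by linarith⟩, hlu, by linarith⟩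
    have h2 := Finset.card_le_card hs
    have h3 := Finset.card_union_le W (U.erase v)
    have h4 := Finset.card_erase_lt_of_mem hv
    omega
  · push Not at hcase
    refine le_trans ?_ (Nat.le_add_left _ _)
    have hrank : ∀ w ∈ W, ∀ X : Finset V, (∀ u ∈ X, p b < p u ∧ p u < p w ∧ l u ≤ y ∧ z h1 ≤ r u) →
        X.card < 3 * t := by
      intro w hw X hX
      have hs : X ⊆ W.erase w ∪ V' := by
        intro u hu
        obtain ⟨u1, u2, u3, u4⟩ := hX u hu
        rw [Finset.mem_union]
        by_cases hlu : l u ≤ z h1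
        · left
          rw [Finset.mem_erase]
          exact ⟨fun e => by subst e; exact lt_irrefl _ u2, key w hw u u1 u2 hlu u4⟩
        · right
          push Not at hlu
          simp only [hV', Finset.mem_filter, Finset.mem_univ, true_and]
          exact ⟨u1, ⟨w, hw, u2⟩, hlu, u3⟩
      have h2 := Finset.card_le_card hs
      have h3 := Finset.card_union_le (W.erase w) V'
      have h4 := Finset.card_erase_lt_of_mem hw
      omega
    have hS : (W.filter fun w => y ≤ r w).card < t := by
      by_contra hcon
      push Not at hcon
      obtain ⟨S, hSs, hSc⟩ := Finset.exists_subset_card_eq hcon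
      apply free
      refine ⟨S, hSc, ?_⟩
      intro w hw h hh
      have hw' := hSs hw
      rw [Finset.mem_filter] at hw'
      obtain ⟨hwW, hwy⟩ := hw'
      obtain ⟨w0, w1, w2, w3, w4⟩ := hWm w hwW
      obtain ⟨⟨a1, a2, a3, a4⟩, hc⟩ := hT h hh
      have hz1 := hmin h hh
      have hz2 := hy h hh
      refine ⟨by linarith, ?_, by linarith, by linarith⟩
      by_contra hlt
      push Not at hlt
      have := hrank w hwW (rightOf p l r lo hi z b h) (by
        intro u hu
        simp only [rightOf, Finset.mem_filter, Finset.mem_univ, true_and] at hu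
        obtain ⟨u0, u1, u2, u3, u4⟩ := hu
        exact ⟨u0, by linarith, by linarith, by linarith⟩)
      omega
    have hsum := Finset.card_filter_add_card_filter_not (s := W) (fun w => y ≤ r w)
    have hle : (W.filter fun w => ¬ y ≤ r w).card ≤
        ((delEv p l r t b).filter fun v => z h1 ≤ r v ∧ r v < y).card := by
      apply Finset.card_le_card
      intro w hw
      rw [Finset.mem_filter] at hw
      obtain ⟨hwW, hwy⟩ := hw
      push Not at hwy
      obtain ⟨w0, w1, w2, w3, w4⟩ := hWm w hwW
      simp only [delEv, Finset.mem_filter, Finset.mem_univ, true_and]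
      refine ⟨⟨w0, by linarith, by linarith, ?_⟩, w4, hwy⟩
      apply hrank w hwW
      intro u hu
      simp only [Finset.mem_filter, Finset.mem_univ, true_and] at hu
      obtain ⟨u1, u2, u3, u4⟩ := hu
      exact ⟨u1, u2, by linarith, by linarith⟩
    omega

lemma chain (p l r : V → ℝ) (lo hi z : H → ℝ) (t : ℕ) (ht : 0 < t) (b : V) (Hs : Finset H)
    (free : ¬ ∃ (S : Finset V) (T : Finset H), S.card = t ∧ T.card = t ∧ T ⊆ Hs ∧
      ∀ v ∈ S, ∀ h ∈ T, Adj2 p l r lo hi z v h) :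
    ∀ (k : ℕ) (D : Finset H), D.card = k → D ⊆ Hs →
    (∀ h ∈ D, Adj2 p l r lo hi z b h ∧ 3 * t ≤ (rightOf p l r lo hi z b h).card) →
    ∀ x : ℝ, (∀ h ∈ D, x ≤ z h) →
    D.card ≤ t + ((insEv p l r t b).filter fun v => x < l v).card
      + ((delEv p l r t b).filter fun v => x ≤ r v).card := by
  intro k
  induction k using Nat.strong_induction_on with
  | _ k ih =>
  intro D hDk hDs hD x hx
  by_cases hsmall : D.card ≤ t
  · omega
  push Not at hsmall
  obtain ⟨T, hTD, hTc, hTd⟩ := first_t t z D hsmall.le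
  have hTne : T.Nonempty := by rw [← Finset.card_pos]; omega
  obtain ⟨h1, hh1, hmin⟩ := Finset.exists_min_image T z hTne
  obtain ⟨h2, hh2, hmax⟩ := Finset.exists_max_image T z hTne
  have hg := group p l r lo hi z t ht b T h1 hh1 hmin (z h2) hmax
    (hD h2 (hTD hh2)).1.2.2.2 (fun h hh => hD h (hTD hh)) (by
      rintro ⟨S, hS, hS2⟩
      exact free ⟨S, T, hS, hTc, hTD.trans hDs, hS2⟩)
  have hcD : (D \ T).card = D.card - t := by
    rw [Finset.card_sdiff_of_subset hTD, hTc]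
  have hi := ih (D \ T).card (by omega) (D \ T) rfl (Finset.sdiff_subset.trans hDs)
    (fun h hh => hD h (Finset.sdiff_subset hh)) (z h2) (by
      intro h hh
      rw [Finset.mem_sdiff] at hh
      by_contra hcon
      push Not at hcon
      exact hh.2 (hTd h2 hh2 h hh.1 hcon))
  have hx1 := hx h1 (hTD hh1)
  have h12 := hmin h2 hh2
  have e1 : ((insEv p l r t b).filter fun v => z h1 < l v ∧ l v ≤ z h2).card
      + ((insEv p l r t b).filter fun v => z h2 < l v).card
      ≤ ((insEv p l r t b).filter fun v => x < l v).card := by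
    rw [← Finset.card_union_of_disjoint]
    · apply Finset.card_le_card
      intro v hv
      simp only [Finset.mem_union, Finset.mem_filter] at hv ⊢
      rcases hv with ⟨a, b, c⟩ | ⟨a, b⟩
      · exact ⟨a, by linarith⟩
      · exact ⟨a, by linarith⟩
    · rw [Finset.disjoint_left]
      intro v hv hv2
      simp only [Finset.mem_filter] at hv hv2
      linarith [hv.2.2, hv2.2]
  have e2 : ((delEv p l r t b).filter fun v => z h1 ≤ r v ∧ r v < z h2).card
      + ((delEv p l r t b).filter fun v => z h2 ≤ r v).card
      ≤ ((delEv p l r t b).filter fun v => x ≤ r v).card := by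
    rw [← Finset.card_union_of_disjoint]
    · apply Finset.card_le_card
      intro v hv
      simp only [Finset.mem_union, Finset.mem_filter] at hv ⊢
      rcases hv with ⟨a, b, c⟩ | ⟨a, b⟩
      · exact ⟨a, by linarith⟩
      · exact ⟨a, by linarith⟩
    · rw [Finset.disjoint_left]
      intro v hv hv2
      simp only [Finset.mem_filter] at hv hv2
      linarith [hv.2.2, hv2.2]
  omega

/-- planar bound -/
lemma planar (p l r : V → ℝ) (hp : Function.Injective p) (lo hi z : H → ℝ)
    (t : ℕ) (ht : 0 < t) (Hs : Finset H)
    (free : ¬ ∃ (S : Finset V) (T : Finset H), S.card = t ∧ T.card = t ∧ T ⊆ Hs ∧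
      ∀ v ∈ S, ∀ h ∈ T, Adj2 p l r lo hi z v h) :
    (Finset.univ.filter fun e : V × H => e.2 ∈ Hs ∧ Adj2 p l r lo hi z e.1 e.2).card
      ≤ 7 * t * Fintype.card V + 3 * t * Fintype.card H := by
  have hgood : (Finset.univ.filter fun e : V × H => e.2 ∈ Hs ∧ Adj2 p l r lo hi z e.1 e.2 ∧
      3 * t ≤ (rightOf p l r lo hi z e.1 e.2).card).card ≤ 7 * t * Fintype.card V := by
    have h0 : (Finset.univ.filter fun e : V × H => e.2 ∈ Hs ∧ Adj2 p l r lo hi z e.1 e.2 ∧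
        3 * t ≤ (rightOf p l r lo hi z e.1 e.2).card).card
        = ∑ b : V, (Finset.univ.filter fun h : H => h ∈ Hs ∧ Adj2 p l r lo hi z b h ∧
          3 * t ≤ (rightOf p l r lo hi z b h).card).card := by
      simp only [Finset.card_filter]
      rw [Fintype.sum_prod_type]
    rw [h0]
    have h1 : ∀ b : V, (Finset.univ.filter fun h : H => h ∈ Hs ∧ Adj2 p l r lo hi z b h ∧
          3 * t ≤ (rightOf p l r lo hi z b h).card).card
          ≤ t + (insEv p l r t b).card + (delEv p l r t b).card := by
      intro b
      have := chain p l r lo hi z t ht b Hs free _ (Finset.univ.filter fun h : H => h ∈ Hs ∧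
        Adj2 p l r lo hi z b h ∧ 3 * t ≤ (rightOf p l r lo hi z b h).card) rfl
        (fun h hh => by simp only [Finset.mem_filter] at hh; exact hh.2.1)
        (fun h hh => by simp only [Finset.mem_filter] at hh; exact hh.2.2)
        (l b) (fun h hh => by simp only [Finset.mem_filter] at hh; exact hh.2.2.1.2.2.1)
      have a1 := Finset.card_filter_le (insEv p l r t b) (fun v => l b < l v)
      have a2 := Finset.card_filter_le (delEv p l r t b) (fun v => l b ≤ r v)
      omega
    calc _ ≤ ∑ b : V, (t + (insEv p l r t b).card + (delEv p l r t b).card) :=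
          Finset.sum_le_sum fun b _ => h1 b
      _ = t * Fintype.card V + ∑ b, (insEv p l r t b).card + ∑ b, (delEv p l r t b).card := by
          simp [Finset.sum_add_distrib, mul_comm]
      _ ≤ t * Fintype.card V + 3 * t * Fintype.card V + 3 * t * Fintype.card V := by
          gcongr
          · exact ins_total p l r hp t ht
          · exact del_total p l r hp t ht
      _ = _ := by ring
  have hbad : (Finset.univ.filter fun e : V × H => Adj2 p l r lo hi z e.1 e.2 ∧
      (rightOf p l r lo hi z e.1 e.2).card < 3 * t).card ≤ 3 * t * Fintype.card H := by
    have h0 : (Finset.univ.filter fun e : V × H => Adj2 p l r lo hi z e.1 e.2 ∧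
        (rightOf p l r lo hi z e.1 e.2).card < 3 * t).card
        = ∑ h : H, (Finset.univ.filter fun b : V => Adj2 p l r lo hi z b h ∧
          (rightOf p l r lo hi z b h).card < 3 * t).card := by
      simp only [Finset.card_filter]
      rw [Fintype.sum_prod_type, Finset.sum_comm]
    rw [h0]
    calc _ ≤ ∑ _h : H, 3 * t := Finset.sum_le_sum fun h _ => ?_
      _ = _ := by simp [mul_comm]
    apply few _ p _ (by omega)
    intro v hv hm
    simp only [Finset.mem_filter, Finset.mem_univ, true_and] at hv
    refine lt_of_le_of_lt (Finset.card_le_card ?_) hv.2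
    intro u hu
    rw [Finset.mem_erase] at hu
    have h1 := hm u hu.2
    have h2 := hu.2
    rw [Finset.mem_filter] at h2
    simp only [rightOf, Finset.mem_filter, Finset.mem_univ, true_and]
    exact ⟨lt_of_le_of_ne h1 fun e => hu.1 (hp e.symm), h2.2.1⟩
  refine le_trans (Finset.card_le_card ?_) (le_trans (Finset.card_union_le _ _)
    (Nat.add_le_add hgood hbad))
  intro e he
  simp only [Finset.mem_union, Finset.mem_filter, Finset.mem_univ, true_and] at he ⊢
  by_cases hc : 3 * t ≤ (rightOf p l r lo hi z e.1 e.2).card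
  · exact Or.inl ⟨he.1, he.2, hc⟩
  · exact Or.inr ⟨he.2, not_le.1 hc⟩

end planar

lemma common {α H : Type} (t : ℕ) (q : α → ℝ) (hq : Function.Injective q) (C : Finset α)
    (G : Finset H) (hG : G.Nonempty) (N : H → Finset α) (hN : ∀ h ∈ G, N h ⊆ C)
    (hd : ∀ h ∈ G, ∀ u ∈ C, ∀ v ∈ N h, q u < q v → u ∈ N h) (ht : ∀ h ∈ G, t ≤ (N h).card) :
    ∃ T : Finset α, T.card = t ∧ ∀ h ∈ G, T ⊆ N h := by
  obtain ⟨h0, hh0⟩ := hG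
  obtain ⟨T, -, hc, hT⟩ := first_t_sub t q hq C
    ((ht h0 hh0).trans (Finset.card_le_card (hN h0 hh0)))
  exact ⟨T, hc, fun h hh => hT _ (hN h hh) (hd h hh) (ht h hh)⟩

/-- elements beyond `b` (in direction `q`), satisfying `c`, inside the range -/
noncomputable def sideSet {α : Type} [Fintype α] (p q : α → ℝ) (c : α → Prop) (b : α)
    (lo hi : ℝ) : Finset α :=
  Finset.univ.filter fun v => q b < q v ∧ c v ∧ lo ≤ p v ∧ p v ≤ hi

lemma common_side {α H : Type} [Fintype α] (t : ℕ) (p q : α → ℝ) (hp : Function.Injective p)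
    (hq : (∀ v, q v = p v) ∨ (∀ v, q v = - p v)) (c : α → Prop) (b : α)
    (G : Finset H) (hG : G.Nonempty) (lo hi : H → ℝ)
    (hb : ∀ h ∈ G, lo h ≤ p b ∧ p b ≤ hi h)
    (ht : ∀ h ∈ G, t ≤ (sideSet p q c b (lo h) (hi h)).card) :
    ∃ T : Finset α, T.card = t ∧ ∀ h ∈ G, ∀ v ∈ T, c v ∧ lo h ≤ p v ∧ p v ≤ hi h := by
  have hqi : Function.Injective q := by
    intro u v huv
    apply hp
    rcases hq with hq | hq
    · rw [← hq, ← hq, huv]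
    · have h1 := hq u
      have h2 := hq v
      linarith
  obtain ⟨T, hT, hT2⟩ := common t q hqi (Finset.univ.filter fun v => q b < q v ∧ c v) G hG
    (fun h => sideSet p q c b (lo h) (hi h))
    (by
      intro h _ v hv
      simp only [sideSet, Finset.mem_filter, Finset.mem_univ, true_and] at hv ⊢
      exact ⟨hv.1, hv.2.1⟩)
    (by
      intro h hh u hu v hv huv
      have hbh := hb h hh
      simp only [sideSet, Finset.mem_filter, Finset.mem_univ, true_and] at hu hv ⊢
      refine ⟨hu.1, hu.2, ?_⟩
      rcases hq with hq | hq
      · rw [hq, hq] at huv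
        have h3 := hu.1
        rw [hq, hq] at h3
        exact ⟨by linarith [hbh.1], by linarith [hv.2.2.2]⟩
      · rw [hq, hq] at huv
        have h3 := hu.1
        rw [hq, hq] at h3
        exact ⟨by linarith [hv.2.2.1], by linarith [hbh.2]⟩) ht
  refine ⟨T, hT, ?_⟩
  intro h hh v hv
  have := hT2 h hh hv
  simp only [sideSet, Finset.mem_filter, Finset.mem_univ, true_and] at this
  exact this.2

section multi
variable {ι : Type} [Fintype ι] {V : ι → Type} [∀ i, Fintype (V i)] {H : Type} [Fintype H]

/-- number of partial tuples omitting `i` -/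
noncomputable def Q (V : ι → Type) (i : ι) : ℕ := Nat.card (∀ j : {j // j ≠ i}, V j)

lemma fiber_f (E : Finset ((∀ i, V i) × H)) (k : ℕ)
    (h : ∀ f, (Finset.univ.filter fun x : H => (f, x) ∈ E).card ≤ k) :
    E.card ≤ k * Nat.card (∀ i, V i) := by
  have : E.card = ∑ f, (Finset.univ.filter fun x : H => (f, x) ∈ E).card := by
    simp only [Finset.card_filter]
    rw [← Fintype.sum_prod_type (f := fun e : (∀ i, V i) × H => if (e.1, e.2) ∈ E then 1 else 0)]
    simp
  rw [this, Nat.card_eq_fintype_card]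
  calc _ ≤ ∑ _f : (∀ i, V i), k := Finset.sum_le_sum fun f _ => h f
    _ = _ := by simp [mul_comm]

lemma fiber_i (E : Finset ((∀ i, V i) × H)) (i : ι) (k : ℕ)
    (h : ∀ f x, (Finset.univ.filter fun v : V i => (Function.update f i v, x) ∈ E).card ≤ k) :
    E.card ≤ k * (Q V i * Fintype.card H) := by
  have h1 := Finset.card_le_mul_card_image_of_maps_to (s := E)
    (t := (Finset.univ : Finset ((∀ j : {j // j ≠ i}, V j) × H)))
    (f := fun e => ((fun j : {j // j ≠ i} => e.1 j), e.2)) (fun _ _ => Finset.mem_univ _) k (by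
      intro b _
      rcases (E.filter fun e => ((fun j : {j // j ≠ i} => e.1 j), e.2) = b).eq_empty_or_nonempty
        with h0 | ⟨e0, he0⟩
      · rw [h0]; simp
      refine le_trans ?_ (h e0.1 e0.2)
      rw [Finset.mem_filter] at he0
      have hup : ∀ e ∈ (E.filter fun e => ((fun j : {j // j ≠ i} => e.1 j), e.2) = b),
          (Function.update e0.1 i (e.1 i), e0.2) = e := by
        intro e he
        rw [Finset.mem_filter] at he
        have h2 := he.2.trans he0.2.symm
        rw [Prod.ext_iff] at h2
        apply Prod.ext
        · funext j
          by_cases hj : j = i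
          · subst hj; simp
          · have := congrFun h2.1 ⟨j, hj⟩
            simp only [Function.update_of_ne hj]
            exact this.symm
        · exact h2.2.symm
      apply Finset.card_le_card_of_injOn (fun e => e.1 i)
      · intro e he
        have h3 := hup e he
        rw [Finset.mem_coe, Finset.mem_filter] at he
        simp only [Finset.coe_filter, Finset.mem_univ, true_and, Set.mem_setOf_eq]
        rw [h3]
        exact he.1
      · intro e he e' he' hee
        rw [← hup e he, ← hup e' he']
        simp only at hee
        rw [hee])
  refine h1.trans (le_of_eq ?_)
  rw [Finset.card_univ, Fintype.card_prod, Q, Nat.card_eq_fintype_card]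

lemma upward [Nonempty ι] (p r : ∀ i, V i → ℝ) (hp : ∀ i, Function.Injective (p i))
    (lo hi : H → ι → ℝ) (z : H → ℝ) (t : ℕ) (ht : 0 < t) (Hs : Finset H)
    (free : ¬ ∃ (S : ∀ i, Finset (V i)) (T : Finset H), (∀ i, (S i).card = t) ∧ T.card = t ∧
      T ⊆ Hs ∧ ∀ i, ∀ v ∈ S i, ∀ h ∈ T, lo h i ≤ p i v ∧ p i v ≤ hi h i ∧ z h ≤ r i v) :
    (Finset.univ.filter fun e : (∀ i, V i) × H => e.2 ∈ Hs ∧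
      ∀ i, lo e.2 i ≤ p i (e.1 i) ∧ p i (e.1 i) ≤ hi e.2 i ∧ z e.2 ≤ r i (e.1 i)).card
    ≤ 2 * t * Nat.card (∀ i, V i) + ∑ i, 3 * t * (Q V i * Fintype.card H) := by
  have hex : ∀ f : (∀ i, V i), ∃ i, ∀ j, r i (f i) ≤ r j (f j) := fun f =>
    Finite.exists_min (fun i => r i (f i))
  choose is his using hex
  let A : (∀ i, V i) → H → Prop := fun f h => h ∈ Hs ∧
      ∀ i, lo h i ≤ p i (f i) ∧ p i (f i) ≤ hi h i ∧ z h ≤ r i (f i)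
  let side : (q : ∀ i, V i → ℝ) → (∀ i, V i) → H → ∀ i, Finset (V i) := fun q f h i =>
    sideSet (p i) (q i) (fun v => r (is f) (f (is f)) ≤ r i v) (f i) (lo h i) (hi h i)
  let np : ∀ i, V i → ℝ := fun i v => - p i v
  let mix : (∀ i, V i) → ∀ i, V i → ℝ := fun f i => if i = is f then np i else p i
  -- good tuples
  have good : ∀ (f : ∀ i, V i) (q : ∀ i, V i → ℝ),
      (∀ i, (∀ v, q i v = p i v) ∨ (∀ v, q i v = - p i v)) →
      (Finset.univ.filter fun h => A f h ∧ ∀ i, t ≤ (side q f h i).card).card ≤ t := by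
    intro f q hq
    by_contra hcon
    push Not at hcon
    obtain ⟨G, hGs, hGc⟩ := Finset.exists_subset_card_eq hcon.le
    have hGm : ∀ h ∈ G, A f h ∧ ∀ i, t ≤ (side q f h i).card := by
      intro h hh
      have := hGs hh
      rw [Finset.mem_filter] at this
      exact this.2
    have hGne : G.Nonempty := by rw [← Finset.card_pos]; omega
    have hT : ∀ i, ∃ T : Finset (V i), T.card = t ∧ ∀ h ∈ G, ∀ v ∈ T,
        r (is f) (f (is f)) ≤ r i v ∧ lo h i ≤ p i v ∧ p i v ≤ hi h i := by
      intro i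
      exact common_side t (p i) (q i) (hp i) (hq i) _ (f i) G hGne (fun h => lo h i)
        (fun h => hi h i) (fun h hh => ⟨((hGm h hh).1.2 i).1, ((hGm h hh).1.2 i).2.1⟩)
        (fun h hh => (hGm h hh).2 i)
    choose S hS1 hS2 using hT
    apply free
    refine ⟨S, G, hS1, hGc, fun h hh => (hGm h hh).1.1, ?_⟩
    intro i v hv h hh
    obtain ⟨a, b, c⟩ := hS2 i h hh v hv
    exact ⟨b, c, ((hGm h hh).1.2 (is f)).2.2.trans a⟩
  have hGR : (Finset.univ.filter fun e : (∀ i, V i) × H => A e.1 e.2 ∧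
      ∀ i, t ≤ (side p e.1 e.2 i).card).card ≤ t * Nat.card (∀ i, V i) := by
    apply fiber_f
    intro f
    simp only [Finset.mem_filter, Finset.mem_univ, true_and]
    exact good f p (fun i => Or.inl fun v => rfl)
  have hGL : (Finset.univ.filter fun e : (∀ i, V i) × H => A e.1 e.2 ∧
      ∀ i, t ≤ (side (mix e.1) e.1 e.2 i).card).card ≤ t * Nat.card (∀ i, V i) := by
    apply fiber_f
    intro f
    simp only [Finset.mem_filter, Finset.mem_univ, true_and]
    refine good f (mix f) (fun i => ?_)
    by_cases hi : i = is f
    · right; intro v; simp [mix, np, hi]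
    · left; intro v; simp [mix, hi]
  -- bad tuples
  let Bad : ι → Finset ((∀ i, V i) × H) := fun i => Finset.univ.filter fun e =>
    A e.1 e.2 ∧ (side p e.1 e.2 i).card < t ∧ ((side np e.1 e.2 i).card < t ∨ i ≠ is e.1)
  have hBad : ∀ i, (Bad i).card ≤ 3 * t * (Q V i * Fintype.card H) := by
    intro i
    apply fiber_i
    intro f h
    let u : V i → ∀ j, V j := fun v => Function.update f i v
    have hui : ∀ v, u v i = v := fun v => by simp [u]
    have huj : ∀ v w j, j ≠ i → u v j = u w j := fun v w j hj => by simp [u, hj]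
    let X1 : Finset (V i) := Finset.univ.filter fun v => A (u v) h ∧
      (side p (u v) h i).card < t ∧ i ≠ is (u v)
    let X2 : Finset (V i) := Finset.univ.filter fun v => A (u v) h ∧
      (side p (u v) h i).card < t ∧ (side np (u v) h i).card < t ∧ i = is (u v)
    have hX1 : X1.card ≤ t := by
      apply few _ (p i) _ ht
      intro v hv hm
      have hv' := (Finset.mem_filter.1 hv).2
      refine lt_of_le_of_lt (Finset.card_le_card ?_) hv'.2.1
      intro w hw
      rw [Finset.mem_erase] at hw
      have hw' := (Finset.mem_filter.1 hw.2).2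
      have hle := hm w hw.2
      simp only [side, sideSet, Finset.mem_filter, Finset.mem_univ, true_and]
      have hwi := hw'.1.2 i
      rw [hui] at hwi
      refine ⟨?_, ?_, hwi.1, hwi.2.1⟩
      · rw [hui]
        exact lt_of_le_of_ne hle fun e => hw.1 (hp i e.symm)
      · have a1 := his (u v) (is (u w))
        rw [huj v w _ (Ne.symm hw'.2.2)] at a1
        have a2 := his (u w) i
        rw [hui] at a2
        exact a1.trans a2
    have hX2 : X2.card ≤ 2 * t := by
      apply few _ (r i) _ (by omega)
      intro v hv hm
      have hv' := (Finset.mem_filter.1 hv).2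
      have hs : X2.erase v ⊆ side p (u v) h i ∪ side np (u v) h i := by
        intro w hw
        rw [Finset.mem_erase] at hw
        have hw' := (Finset.mem_filter.1 hw.2).2
        have hle := hm w hw.2
        have hwi := hw'.1.2 i
        rw [hui] at hwi
        have hr : r (is (u v)) (u v (is (u v))) ≤ r i w := by
          have := his (u v) i
          rw [hui] at this
          exact this.trans hle
        rw [Finset.mem_union]
        simp only [side, sideSet, Finset.mem_filter, Finset.mem_univ, true_and, np]
        rw [hui]
        rcases lt_trichotomy (p i v) (p i w) with h1 | h1 | h1
        · exact Or.inl ⟨h1, hr, hwi.1, hwi.2.1⟩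
        · exact absurd (hp i h1).symm hw.1
        · exact Or.inr ⟨neg_lt_neg h1, hr, hwi.1, hwi.2.1⟩
      have h1 := Finset.card_le_card hs
      have h2 := Finset.card_union_le (side p (u v) h i) (side np (u v) h i)
      have h3 := hv'.2.1
      have h4 := hv'.2.2.1
      omega
    have hs : (Finset.univ.filter fun v : V i => (Function.update f i v, h) ∈ Bad i)
        ⊆ X1 ∪ X2 := by
      intro v hv
      have hv' := (Finset.mem_filter.1 (Finset.mem_filter.1 hv).2).2
      rw [Finset.mem_union]
      by_cases hi : i = is (u v)
      · right
        refine Finset.mem_filter.2 ⟨Finset.mem_univ _, hv'.1, hv'.2.1, ?_, hi⟩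
        rcases hv'.2.2 with h1 | h1
        · exact h1
        · exact absurd hi h1
      · left
        exact Finset.mem_filter.2 ⟨Finset.mem_univ _, hv'.1, hv'.2.1, hi⟩
    have h1 := Finset.card_le_card hs
    have h2 := Finset.card_union_le X1 X2
    omega
  have hcover : (Finset.univ.filter fun e : (∀ i, V i) × H => e.2 ∈ Hs ∧
      ∀ i, lo e.2 i ≤ p i (e.1 i) ∧ p i (e.1 i) ≤ hi e.2 i ∧ z e.2 ≤ r i (e.1 i)) ⊆
      ((Finset.univ.filter fun e : (∀ i, V i) × H => A e.1 e.2 ∧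
        ∀ i, t ≤ (side p e.1 e.2 i).card) ∪
      (Finset.univ.filter fun e : (∀ i, V i) × H => A e.1 e.2 ∧
        ∀ i, t ≤ (side (mix e.1) e.1 e.2 i).card)) ∪ Finset.univ.biUnion Bad := by
    intro e he
    have he' : A e.1 e.2 := (Finset.mem_filter.1 he).2
    by_cases hb : ∃ i, e ∈ Bad i
    · obtain ⟨i, hi⟩ := hb
      exact Finset.mem_union_right _ (Finset.mem_biUnion.2 ⟨i, Finset.mem_univ _, hi⟩)
    · apply Finset.mem_union_left
      have hnb : ∀ i, t ≤ (side p e.1 e.2 i).card ∨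
          (t ≤ (side np e.1 e.2 i).card ∧ i = is e.1) := by
        intro i
        by_contra hcon
        push Not at hcon
        apply hb
        refine ⟨i, Finset.mem_filter.2 ⟨Finset.mem_univ _, he', hcon.1, ?_⟩⟩
        by_cases h1 : (side np e.1 e.2 i).card < t
        · exact Or.inl h1
        · exact Or.inr (hcon.2 (not_lt.1 h1))
      rw [Finset.mem_union]
      by_cases hc : t ≤ (side p e.1 e.2 (is e.1)).card
      · left
        refine Finset.mem_filter.2 ⟨Finset.mem_univ _, he', fun i => ?_⟩
        rcases hnb i with h1 | ⟨_, h1⟩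
        · exact h1
        · rw [h1]; exact hc
      · right
        refine Finset.mem_filter.2 ⟨Finset.mem_univ _, he', fun i => ?_⟩
        by_cases hi : i = is e.1
        · have h2 : (side (mix e.1) e.1 e.2 i) = side np e.1 e.2 i := by
            simp only [side, mix, if_pos hi]
          rw [h2]
          rcases hnb i with h1 | ⟨h1, _⟩
          · rw [hi] at h1
            exact absurd h1 hc
          · exact h1
        · have h2 : (side (mix e.1) e.1 e.2 i) = side p e.1 e.2 i := by
            simp only [side, mix, if_neg hi]
          rw [h2]
          rcases hnb i with h1 | ⟨_, h1⟩
          · exact h1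
          · exact absurd h1 hi
  refine (Finset.card_le_card hcover).trans ((Finset.card_union_le _ _).trans ?_)
  apply Nat.add_le_add
  · refine (Finset.card_union_le _ _).trans ((Nat.add_le_add hGR hGL).trans (le_of_eq ?_))
    ring
  · exact Finset.card_biUnion_le.trans (Finset.sum_le_sum fun i _ => hBad i)

lemma middle (p : ∀ i, V i → ℝ) (hp : ∀ i, Function.Injective (p i)) (i0 : ι)
    (l r : V i0 → ℝ)
    (lo hi : H → ι → ℝ) (z : H → ℝ) (t : ℕ) (ht : 0 < t) (Hs : Finset H)
    (free : ¬ ∃ (S : ∀ i, Finset (V i)) (T : Finset H), (∀ i, (S i).card = t) ∧ T.card = t ∧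
      T ⊆ Hs ∧ (∀ i, ∀ v ∈ S i, ∀ h ∈ T, lo h i ≤ p i v ∧ p i v ≤ hi h i) ∧
      ∀ v ∈ S i0, ∀ h ∈ T, l v ≤ z h ∧ z h ≤ r v) :
    (Finset.univ.filter fun e : (∀ i, V i) × H => e.2 ∈ Hs ∧
      (∀ i, lo e.2 i ≤ p i (e.1 i) ∧ p i (e.1 i) ≤ hi e.2 i) ∧
      l (e.1 i0) ≤ z e.2 ∧ z e.2 ≤ r (e.1 i0)).card
    ≤ (7 * t * Fintype.card (V i0) + 3 * t * Fintype.card H) * Q V i0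
      + ∑ i, t * (Q V i * Fintype.card H) := by
  let A : (∀ i, V i) → H → Prop := fun f h => h ∈ Hs ∧
      (∀ i, lo h i ≤ p i (f i) ∧ p i (f i) ≤ hi h i) ∧ l (f i0) ≤ z h ∧ z h ≤ r (f i0)
  let side : ∀ i, V i → H → Finset (V i) := fun i b h =>
    sideSet (p i) (p i) (fun _ => True) b (lo h i) (hi h i)
  let Bad : ι → Finset ((∀ i, V i) × H) := fun i => Finset.univ.filter fun e =>
    A e.1 e.2 ∧ (side i (e.1 i) e.2).card < t
  have hBad : ∀ i, (Bad i).card ≤ t * (Q V i * Fintype.card H) := by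
    intro i
    apply fiber_i
    intro f h
    apply few _ (p i) _ ht
    intro v hv hm
    have hv' := (Finset.mem_filter.1 (Finset.mem_filter.1 hv).2).2
    simp only [Function.update_self] at hv'
    refine lt_of_le_of_lt (Finset.card_le_card ?_) hv'.2
    intro w hw
    rw [Finset.mem_erase] at hw
    have hw' := (Finset.mem_filter.1 (Finset.mem_filter.1 hw.2).2).2.1.2.1 i
    simp only [Function.update_self] at hw'
    have hle := hm w hw.2
    simp only [side, sideSet, Finset.mem_filter, Finset.mem_univ, true_and]
    exact ⟨lt_of_le_of_ne hle fun e => hw.1 (hp i e.symm), hw'⟩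
  let Gd : Finset ((∀ i, V i) × H) := Finset.univ.filter fun e =>
    A e.1 e.2 ∧ ∀ i, i ≠ i0 → t ≤ (side i (e.1 i) e.2).card
  have hGd : Gd.card ≤ (7 * t * Fintype.card (V i0) + 3 * t * Fintype.card H) * Q V i0 := by
    have h1 := Finset.card_le_mul_card_image_of_maps_to (s := Gd)
      (t := (Finset.univ : Finset (∀ j : {j // j ≠ i0}, V j)))
      (f := fun e => (fun j : {j // j ≠ i0} => e.1 j)) (fun _ _ => Finset.mem_univ _)
      (7 * t * Fintype.card (V i0) + 3 * t * Fintype.card H) (by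
        intro g _
        let Hg : Finset H := Finset.univ.filter fun h => h ∈ Hs ∧ ∀ j : {j // j ≠ i0},
          (lo h j ≤ p j (g j) ∧ p j (g j) ≤ hi h j) ∧ t ≤ (side j (g j) h).card
        refine le_trans ?_ (planar (p i0) l r (hp i0) (fun h => lo h i0) (fun h => hi h i0) z t ht
          Hg ?_)
        · apply Finset.card_le_card_of_injOn (fun e => (e.1 i0, e.2))
          · intro e he
            rw [Finset.mem_coe, Finset.mem_filter] at he
            obtain ⟨he1, he2⟩ := he
            have he1 := (Finset.mem_filter.1 he1).2
            rw [Finset.mem_coe]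
            refine Finset.mem_filter.2 ⟨Finset.mem_univ _, ?_, ?_⟩
            · refine Finset.mem_filter.2 ⟨Finset.mem_univ _, he1.1.1, ?_⟩
              intro j
              have : g j = e.1 j := by rw [← he2]
              rw [this]
              exact ⟨he1.1.2.1 j, he1.2 j j.2⟩
            · exact ⟨(he1.1.2.1 i0).1, (he1.1.2.1 i0).2, he1.1.2.2.1, he1.1.2.2.2⟩
          · intro e he e' he' hee
            rw [Finset.mem_coe, Finset.mem_filter] at he he'
            have h2 := he.2.trans he'.2.symm
            rw [Prod.ext_iff] at hee
            apply Prod.ext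
            · funext j
              by_cases hj : j = i0
              · subst hj; exact hee.1
              · exact congrFun h2 ⟨j, hj⟩
            · exact hee.2
        · rintro ⟨S0, T, hS0, hT, hTs, hST⟩
          have hTne : T.Nonempty := by rw [← Finset.card_pos]; omega
          have hTm : ∀ h ∈ T, h ∈ Hs ∧ ∀ j : {j // j ≠ i0},
              (lo h j ≤ p j (g j) ∧ p j (g j) ≤ hi h j) ∧ t ≤ (side j (g j) h).card :=
            fun h hh => (Finset.mem_filter.1 (hTs hh)).2
          have hex : ∀ i, ∃ S : Finset (V i), S.card = t ∧
              (∀ v ∈ S, ∀ h ∈ T, lo h i ≤ p i v ∧ p i v ≤ hi h i) ∧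
              (∀ e : i = i0, S = e ▸ S0) := by
            intro i
            by_cases hi' : i = i0
            · subst hi'
              exact ⟨S0, hS0, fun v hv h hh => ⟨(hST v hv h hh).1, (hST v hv h hh).2.1⟩,
                fun _ => rfl⟩
            · obtain ⟨S, hS1, hS2⟩ := common_side t (p i) (p i) (hp i) (Or.inl fun _ => rfl)
                (fun _ => True) (g ⟨i, hi'⟩) T hTne (fun h => lo h i) (fun h => hi h i)
                (fun h hh => ((hTm h hh).2 ⟨i, hi'⟩).1) (fun h hh => ((hTm h hh).2 ⟨i, hi'⟩).2)
              exact ⟨S, hS1, fun v hv h hh => (hS2 h hh v hv).2, fun e => absurd e hi'⟩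
          choose S hS1 hS2 hS3 using hex
          apply free
          refine ⟨S, T, hS1, hT, fun h hh => (hTm h hh).1, hS2, ?_⟩
          intro v hv h hh
          have h3 : S i0 = S0 := hS3 i0 rfl
          rw [h3] at hv
          exact (hST v hv h hh).2.2)
    refine h1.trans (le_of_eq ?_)
    rw [Finset.card_univ, Q, Nat.card_eq_fintype_card]
  have hcover : (Finset.univ.filter fun e : (∀ i, V i) × H => e.2 ∈ Hs ∧
      (∀ i, lo e.2 i ≤ p i (e.1 i) ∧ p i (e.1 i) ≤ hi e.2 i) ∧
      l (e.1 i0) ≤ z e.2 ∧ z e.2 ≤ r (e.1 i0)) ⊆ Gd ∪ Finset.univ.biUnion Bad := by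
    intro e he
    have he' : A e.1 e.2 := (Finset.mem_filter.1 he).2
    by_cases hb : ∃ i, e ∈ Bad i
    · obtain ⟨i, hi⟩ := hb
      exact Finset.mem_union_right _ (Finset.mem_biUnion.2 ⟨i, Finset.mem_univ _, hi⟩)
    · apply Finset.mem_union_left
      refine Finset.mem_filter.2 ⟨Finset.mem_univ _, he', fun i _ => ?_⟩
      by_contra hcon
      exact hb ⟨i, Finset.mem_filter.2 ⟨Finset.mem_univ _, he', not_le.1 hcon⟩⟩
  refine (Finset.card_le_card hcover).trans ((Finset.card_union_le _ _).trans ?_)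
  exact Nat.add_le_add hGd (Finset.card_biUnion_le.trans (Finset.sum_le_sum fun i _ => hBad i))

lemma Q_mul (i : ι) : Fintype.card (V i) * Q V i = Nat.card (∀ i, V i) := by
  rw [Q, Nat.card_congr (Equiv.piSplitAt i V), Nat.card_prod, Nat.card_eq_fintype_card (α := V i)]

lemma levels [Nonempty ι] [∀ i, Nonempty (V i)] (l r : ∀ i, V i → ℝ)
    (h : ∀ i j, i ≠ j → ∀ v w, l i v ≤ r j w) :
    ∃ i0 : ι, ∃ α β : ℝ, α ≤ β ∧ (∀ j, j ≠ i0 → ∀ v, l j v ≤ α ∧ β ≤ r j v) ∧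
      (∀ v, l i0 v ≤ β ∧ α ≤ r i0 v) := by
  haveI : Nonempty (Σ i, V i) := ⟨⟨Classical.arbitrary ι, Classical.arbitrary _⟩⟩
  obtain ⟨⟨i1, v1⟩, h1⟩ := Finite.exists_max (fun x : (Σ i, V i) => l x.1 x.2)
  obtain ⟨⟨i2, v2⟩, h2⟩ := Finite.exists_min (fun x : (Σ i, V i) => r x.1 x.2)
  simp only at h1 h2
  by_cases hc : l i1 v1 ≤ r i2 v2
  · exact ⟨i1, l i1 v1, l i1 v1, le_rfl,
      fun j _ v => ⟨h1 ⟨j, v⟩, hc.trans (h2 ⟨j, v⟩)⟩,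
      fun v => ⟨h1 ⟨i1, v⟩, hc.trans (h2 ⟨i1, v⟩)⟩⟩
  · have he : i1 = i2 := by
      by_contra hne
      exact hc (h i1 i2 hne v1 v2)
    subst he
    push Not at hc
    exact ⟨i1, r i1 v2, l i1 v1, hc.le,
      fun j hj v => ⟨h j i1 hj v v2, h i1 j (Ne.symm hj) v1 v⟩,
      fun v => ⟨h1 ⟨i1, v⟩, h2 ⟨i1, v⟩⟩⟩

lemma total [Nonempty ι] [∀ i, Nonempty (V i)] (p l r : ∀ i, V i → ℝ)
    (hp : ∀ i, Function.Injective (p i))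
    (hlr : ∀ i j, i ≠ j → ∀ v w, l i v ≤ r j w)
    (lo hi : H → ι → ℝ) (z : H → ℝ) (t : ℕ) (ht : 0 < t)
    (free : ¬ ∃ (S : ∀ i, Finset (V i)) (T : Finset H), (∀ i, (S i).card = t) ∧ T.card = t ∧
      ∀ i, ∀ v ∈ S i, ∀ h ∈ T, (lo h i ≤ p i v ∧ p i v ≤ hi h i) ∧ l i v ≤ z h ∧ z h ≤ r i v) :
    (Finset.univ.filter fun e : (∀ i, V i) × H => 
      ∀ i, (lo e.2 i ≤ p i (e.1 i) ∧ p i (e.1 i) ≤ hi e.2 i) ∧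
        l i (e.1 i) ≤ z e.2 ∧ z e.2 ≤ r i (e.1 i)).card
    ≤ 11 * t * Nat.card (∀ i, V i) + ∑ i, 10 * t * (Q V i * Fintype.card H) := by
  obtain ⟨i0, α, β, hαβ, hj, h0⟩ := levels l r hlr
  have hlβ : ∀ i v, l i v ≤ β := by
    intro i v
    by_cases hi : i = i0
    · subst hi; exact (h0 v).1
    · exact (hj i hi v).1.trans hαβ
  have hrα : ∀ i v, α ≤ r i v := by
    intro i v
    by_cases hi : i = i0
    · subst hi; exact (h0 v).2
    · exact hαβ.trans (hj i hi v).2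
  have hup := upward p r hp lo hi z t ht (Finset.univ.filter fun h => β ≤ z h) (by
    rintro ⟨S, T, hS, hT, hTs, hST⟩
    refine free ⟨S, T, hS, hT, ?_⟩
    intro i v hv h hh
    obtain ⟨a, b, c⟩ := hST i v hv h hh
    exact ⟨⟨a, b⟩, (hlβ i v).trans (Finset.mem_filter.1 (hTs hh)).2, c⟩)
  have hdn := upward p (fun i v => - l i v) hp lo hi (fun h => - z h) t ht
    (Finset.univ.filter fun h => z h ≤ α) (by
    rintro ⟨S, T, hS, hT, hTs, hST⟩
    refine free ⟨S, T, hS, hT, ?_⟩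
    intro i v hv h hh
    obtain ⟨a, b, c⟩ := hST i v hv h hh
    exact ⟨⟨a, b⟩, neg_le_neg_iff.1 c, (Finset.mem_filter.1 (hTs hh)).2.trans (hrα i v)⟩)
  have hmd := middle p hp i0 (l i0) (r i0) lo hi z t ht
    (Finset.univ.filter fun h => α ≤ z h ∧ z h ≤ β) (by
    rintro ⟨S, T, hS, hT, hTs, hST, hST0⟩
    refine free ⟨S, T, hS, hT, ?_⟩
    intro i v hv h hh
    refine ⟨hST i v hv h hh, ?_⟩
    have hz := (Finset.mem_filter.1 (hTs hh)).2
    by_cases hi : i = i0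
    · subst hi; exact hST0 v hv h hh
    · exact ⟨(hj i hi v).1.trans hz.1, hz.2.trans (hj i hi v).2⟩)
  have hcover : (Finset.univ.filter fun e : (∀ i, V i) × H => 
      ∀ i, (lo e.2 i ≤ p i (e.1 i) ∧ p i (e.1 i) ≤ hi e.2 i) ∧
        l i (e.1 i) ≤ z e.2 ∧ z e.2 ≤ r i (e.1 i)) ⊆ 
      ((Finset.univ.filter fun e : (∀ i, V i) × H =>
        e.2 ∈ (Finset.univ.filter fun h => β ≤ z h) ∧
        ∀ i, lo e.2 i ≤ p i (e.1 i) ∧ p i (e.1 i) ≤ hi e.2 i ∧ z e.2 ≤ r i (e.1 i)) ∪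
      (Finset.univ.filter fun e : (∀ i, V i) × H =>
        e.2 ∈ (Finset.univ.filter fun h => z h ≤ α) ∧
        ∀ i, lo e.2 i ≤ p i (e.1 i) ∧ p i (e.1 i) ≤ hi e.2 i ∧ - z e.2 ≤ - l i (e.1 i))) ∪
      (Finset.univ.filter fun e : (∀ i, V i) × H =>
        e.2 ∈ (Finset.univ.filter fun h => α ≤ z h ∧ z h ≤ β) ∧
        (∀ i, lo e.2 i ≤ p i (e.1 i) ∧ p i (e.1 i) ≤ hi e.2 i) ∧
        l i0 (e.1 i0) ≤ z e.2 ∧ z e.2 ≤ r i0 (e.1 i0)) := by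
    intro e he
    have he := (Finset.mem_filter.1 he).2
    by_cases h1 : β ≤ z e.2
    · apply Finset.mem_union_left
      apply Finset.mem_union_left
      exact Finset.mem_filter.2 ⟨Finset.mem_univ _, Finset.mem_filter.2 ⟨Finset.mem_univ _, h1⟩,
        fun i => ⟨(he i).1.1, (he i).1.2, (he i).2.2⟩⟩
    by_cases h2 : z e.2 ≤ α
    · apply Finset.mem_union_left
      apply Finset.mem_union_right
      exact Finset.mem_filter.2 ⟨Finset.mem_univ _, Finset.mem_filter.2 ⟨Finset.mem_univ _, h2⟩,
        fun i => ⟨(he i).1.1, (he i).1.2, neg_le_neg (he i).2.1⟩⟩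
    · apply Finset.mem_union_right
      push Not at h1 h2
      exact Finset.mem_filter.2 ⟨Finset.mem_univ _,
        Finset.mem_filter.2 ⟨Finset.mem_univ _, h2.le, h1.le⟩, fun i => (he i).1, (he i0).2⟩
  have hc1 := Finset.card_le_card hcover
  have hc2 := hc1.trans ((Finset.card_union_le _ _).trans
    (Nat.add_le_add_right (Finset.card_union_le _ _) _))
  refine hc2.trans ((Nat.add_le_add (Nat.add_le_add hup hdn) hmd).trans ?_)
  have hQ := Q_mul (V := V) i0
  have hs : t * (Q V i0 * Fintype.card H) ≤ ∑ i, t * (Q V i * Fintype.card H) :=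
    Finset.single_le_sum (f := fun i => t * (Q V i * Fintype.card H))
      (fun _ _ => Nat.zero_le _) (Finset.mem_univ i0)
  have e1 : ∑ i, 3 * t * (Q V i * Fintype.card H) = 3 * ∑ i, t * (Q V i * Fintype.card H) := by
    rw [Finset.mul_sum]; exact Finset.sum_congr rfl fun _ _ => by ring
  have e2 : ∑ i, 10 * t * (Q V i * Fintype.card H) = 10 * ∑ i, t * (Q V i * Fintype.card H) := by
    rw [Finset.mul_sum]; exact Finset.sum_congr rfl fun _ _ => by ring
  rw [e1, e2]
  have e3 : (7 * t * Fintype.card (V i0) + 3 * t * Fintype.card H) * Q V i0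
      = 7 * (t * Nat.card (∀ i, V i)) + 3 * (t * (Q V i0 * Fintype.card H)) := by
    rw [← hQ]; ring
  rw [e3]
  nlinarith

lemma total_card [Nonempty ι] [∀ i, Nonempty (V i)] (p l r : ∀ i, V i → ℝ)
    (hp : ∀ i, Function.Injective (p i))
    (hlr : ∀ i j, i ≠ j → ∀ v w, l i v ≤ r j w)
    (lo hi : H → ι → ℝ) (z : H → ℝ) (t : ℕ) (ht : 0 < t)
    (free : ¬ ∃ (S : ∀ i, Finset (V i)) (T : Finset H), (∀ i, (S i).card = t) ∧ T.card = t ∧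
      ∀ i, ∀ v ∈ S i, ∀ h ∈ T, (lo h i ≤ p i v ∧ p i v ≤ hi h i) ∧ l i v ≤ z h ∧ z h ≤ r i v) :
    Nat.card {e : (∀ i, V i) × H //
      ∀ i, (lo e.2 i ≤ p i (e.1 i) ∧ p i (e.1 i) ≤ hi e.2 i) ∧
        l i (e.1 i) ≤ z e.2 ∧ z e.2 ≤ r i (e.1 i)}
    ≤ 11 * t * Nat.card (∀ i, V i) + ∑ i, 10 * t * (Q V i * Fintype.card H) := by
  rw [Nat.card_eq_fintype_card, Fintype.card_subtype]
  exact total p l r hp hlr lo hi z t ht free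

end multi
end
end RB

/-- the restricted case, `e(H) ≤ 27 · g_t(n_1,…,n_d)`. -/
theorem stmt7 (d t : ℕ) (hd : 2 ≤ d) (ht : 2 ≤ t)
    (n : Fin d → ℕ) (hn : ∀ i, 0 < n i)
    (B : ∀ i : Fin d, Fin (n i) → Set (Fin d → ℝ))
    (hB : Restricted n B) (hfree : KFree t n B) :
    (hyperedgeCount n B : ℝ) ≤ 27 * gZ t n := by
  classical
  obtain ⟨m, rfl⟩ : ∃ m, d = m + 1 := ⟨d - 1, by omega⟩
  obtain ⟨⟨hcan, hsep⟩, hres⟩ := hB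
  choose Lo Hi hle hbox hdir using hcan
  have hdeg : ∀ i k, Hi i k i = Lo i k i := by
    intro i k
    have h1 : i ∉ {j | j ≠ i} := by simp
    rw [hdir i k] at h1
    simp only [Set.mem_setOf_eq, not_lt] at h1
    exact le_antisymm h1 (hle i k i)
  have hmem : ∀ i k x, x ∈ B i k ↔ ∀ j, Lo i k j ≤ x j ∧ x j ≤ Hi i k j := by
    intro i k x
    rw [hbox i k]
    rfl
  have hLo : ∀ i k, Lo i k ∈ B i k := by
    intro i k
    rw [hmem]
    exact fun j => ⟨le_rfl, hle i k j⟩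
  haveI : Nonempty (Fin m) := ⟨⟨0, by omega⟩⟩
  haveI : ∀ i : Fin m, Nonempty (Fin (n i.castSucc)) := fun i => ⟨⟨0, hn _⟩⟩
  let f0 : ∀ i, Fin (n i) := fun i => ⟨0, hn i⟩
  have hres' : ∀ f : ∀ i, Fin (n i), ∃ x : Fin (m + 1) → ℝ,
      ∀ i : Fin m, x ∈ B i.castSucc (f i.castSucc) := by
    intro f
    obtain ⟨x, hx⟩ := hres f
    simp only [Set.mem_iInter] at hx
    exact ⟨x, fun i => hx i.castSucc (by simp)⟩
  let p : ∀ i : Fin m, Fin (n i.castSucc) → ℝ := fun i v => Lo i.castSucc v i.castSucc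
  let l : ∀ i : Fin m, Fin (n i.castSucc) → ℝ := fun i v => Lo i.castSucc v (Fin.last m)
  let r : ∀ i : Fin m, Fin (n i.castSucc) → ℝ := fun i v => Hi i.castSucc v (Fin.last m)
  let lo : Fin (n (Fin.last m)) → Fin m → ℝ := fun h i => Lo (Fin.last m) h i.castSucc
  let hi : Fin (n (Fin.last m)) → Fin m → ℝ := fun h i => Hi (Fin.last m) h i.castSucc
  let z : Fin (n (Fin.last m)) → ℝ := fun h => Lo (Fin.last m) h (Fin.last m)
  have hp : ∀ i, Function.Injective (p i) := by
    intro i u v huv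
    by_contra hne
    exact hsep i.castSucc u v hne _ (hLo _ _) _ (hLo _ _) huv
  have hlr : ∀ i j, i ≠ j → ∀ v w, l i v ≤ r j w := by
    intro i j hij v w
    have hij' : i.castSucc ≠ j.castSucc := fun e => hij (Fin.castSucc_injective m e)
    obtain ⟨x, hx⟩ := hres' (Function.update (Function.update f0 i.castSucc v) j.castSucc w)
    have h1 := hx i
    have h2 := hx j
    rw [Function.update_of_ne hij', Function.update_self, hmem] at h1
    rw [Function.update_self, hmem] at h2
    exact (h1 (Fin.last m)).1.trans (h2 (Fin.last m)).2
  -- adjacency characterises hyperedges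
  have hedge : ∀ f : ∀ i, Fin (n i), (⋂ j, B j (f j)).Nonempty ↔
      ∀ i : Fin m, (lo (f (Fin.last m)) i ≤ p i (f i.castSucc) ∧
        p i (f i.castSucc) ≤ hi (f (Fin.last m)) i) ∧
        l i (f i.castSucc) ≤ z (f (Fin.last m)) ∧ z (f (Fin.last m)) ≤ r i (f i.castSucc) := by
    intro f
    constructor
    · rintro ⟨x, hx⟩ i
      rw [Set.mem_iInter] at hx
      have hxi := (hmem _ _ _).1 (hx i.castSucc)
      have hxl := (hmem _ _ _).1 (hx (Fin.last m))
      have e1 : x i.castSucc = p i (f i.castSucc) :=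
        le_antisymm ((hxi i.castSucc).2.trans (hdeg _ _).le) (hxi i.castSucc).1
      have e2 : x (Fin.last m) = z (f (Fin.last m)) :=
        le_antisymm ((hxl (Fin.last m)).2.trans (hdeg _ _).le) (hxl (Fin.last m)).1
      rw [← e1, ← e2]
      exact ⟨hxl i.castSucc, hxi (Fin.last m)⟩
    · intro h
      obtain ⟨y, hy⟩ := hres' f
      have hyp : ∀ i : Fin m, y i.castSucc = p i (f i.castSucc) := by
        intro i
        have := (hmem _ _ _).1 (hy i) i.castSucc
        exact le_antisymm (this.2.trans (hdeg _ _).le) this.1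
      refine ⟨Function.update y (Fin.last m) (z (f (Fin.last m))), ?_⟩
      rw [Set.mem_iInter]
      intro j
      rw [hmem]
      intro k
      induction j using Fin.lastCases with
      | last =>
        induction k using Fin.lastCases with
        | last =>
          rw [Function.update_self]
          exact ⟨le_rfl, hle _ _ _⟩
        | cast k =>
          rw [Function.update_of_ne (Fin.castSucc_lt_last k).ne, hyp]
          exact (h k).1
      | cast j =>
        induction k using Fin.lastCases with
        | last =>
          rw [Function.update_self]
          exact (h j).2
        | cast k =>
          rw [Function.update_of_ne (Fin.castSucc_lt_last k).ne]
          exact (hmem _ _ _).1 (hy j) k.castSucc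
  have htot := RB.total_card p l r hp hlr lo hi z t (by omega) (by
    rintro ⟨S, T, hS, hT, hST⟩
    apply hfree
    refine ⟨Fin.lastCases T S, ?_, ?_⟩
    · intro j
      induction j using Fin.lastCases with
      | last => simpa using hT
      | cast j => simpa using hS j
    · intro f hf
      rw [hedge]
      intro i
      have h1 := hf i.castSucc
      have h2 := hf (Fin.last m)
      simp only [Fin.lastCases_castSucc] at h1
      simp only [Fin.lastCases_last] at h2
      exact hST i _ h1 _ h2)
  have hcount : hyperedgeCount n B ≤
      11 * t * Nat.card (∀ i : Fin m, Fin (n i.castSucc)) +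
      ∑ i, 10 * t * (RB.Q (fun i : Fin m => Fin (n i.castSucc)) i *
        Fintype.card (Fin (n (Fin.last m)))) := by
    refine le_trans ?_ htot
    unfold hyperedgeCount
    refine Nat.card_le_card_of_injective (fun f => ⟨((fun i : Fin m => f.1 i.castSucc),
      f.1 (Fin.last m)), (hedge f.1).1 f.2⟩) ?_
    intro f g hfg
    rw [Subtype.mk.injEq, Prod.mk.injEq] at hfg
    apply Subtype.ext
    funext j
    induction j using Fin.lastCases with
    | last => exact hfg.2
    | cast j => exact congrFun hfg.1 j
  have hnpos : ∀ i, (0 : ℝ) < n i := fun i => by exact_mod_cast hn i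
  have hP : (Nat.card (∀ i : Fin m, Fin (n i.castSucc)) : ℝ) = ∏ i : Fin m, (n i.castSucc : ℝ) := by
    rw [Nat.card_pi]
    push_cast
    simp
  have hQ : ∀ i : Fin m, (RB.Q (fun i : Fin m => Fin (n i.castSucc)) i : ℝ)
      = (∏ i : Fin m, (n i.castSucc : ℝ)) * (1 / (n i.castSucc : ℝ)) := by
    intro i
    have h1 := RB.Q_mul (V := fun i : Fin m => Fin (n i.castSucc)) i
    rw [← hP, ← h1]
    push_cast
    rw [Fintype.card_fin]
    have := hnpos i.castSucc
    field_simp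
  have hcount' : (hyperedgeCount n B : ℝ) ≤
      11 * t * (∏ i : Fin m, (n i.castSucc : ℝ)) +
      ∑ i : Fin m, 10 * t * ((∏ i : Fin m, (n i.castSucc : ℝ)) * (1 / (n i.castSucc : ℝ)) *
        (n (Fin.last m))) := by
    have h1 : (hyperedgeCount n B : ℝ) ≤ _ := Nat.cast_le.2 hcount
    push_cast at h1
    simp only [hQ, hP, Fintype.card_fin] at h1
    exact h1
  refine hcount'.trans ?_
  unfold gZ
  rw [Fin.prod_univ_castSucc, Fin.sum_univ_castSucc]
  set P := ∏ i : Fin m, (n i.castSucc : ℝ) with hPdef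
  have hPpos : 0 ≤ P := Finset.prod_nonneg fun i _ => (hnpos _).le
  have hsum : ∑ i : Fin m, 10 * (t : ℝ) * (P * (1 / (n i.castSucc : ℝ)) * (n (Fin.last m)))
      = 10 * (t * P * n (Fin.last m) * ∑ i : Fin m, 1 / (n i.castSucc : ℝ)) := by
    rw [Finset.mul_sum, Finset.mul_sum]
    exact Finset.sum_congr rfl fun _ _ => by ring
  rw [hsum]
  have hS : 0 ≤ ∑ i : Fin m, 1 / (n i.castSucc : ℝ) :=
    Finset.sum_nonneg fun i _ => by positivity
  have hN := hnpos (Fin.last m)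
  have e : 27 * ((t : ℝ) * (P * n (Fin.last m)) *
      (∑ i : Fin m, 1 / (n i.castSucc : ℝ) + 1 / (n (Fin.last m) : ℝ)))
      = 27 * (t * P * n (Fin.last m) * ∑ i : Fin m, 1 / (n i.castSucc : ℝ)) + 27 * (t * P) := by
    field_simp
  rw [e]
  have a1 : 0 ≤ (t : ℝ) * P * n (Fin.last m) * ∑ i : Fin m, 1 / (n i.castSucc : ℝ) := by positivity
  have a2 : 0 ≤ (t : ℝ) * P := by positivity
  linarith
end

section
/- Let d ≥ 2 be an integer. There exists a constant M_d > 0 (depending only on d) such that for every integer t ≥ 2, every separated family (B_1, …, B_d) in ℝ^d with |B_i| = n_i for i = 1, …, d whose intersection hypergraph H is K_{t,…,t}^{(d)}-free satisfies: the number of hyperedges of H is at most M_d · g_t(n_1, …, n_d). -/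
open Set

section Aux
open Classical in
/-- Bounding a finset by an injective relation to a finset of keys. -/
lemma aux_card_le {A K : Type*} (F : Finset A) (G : Finset K) (r : A → K → Prop)
    (h1 : ∀ e ∈ F, ∃ k ∈ G, r e k)
    (h2 : ∀ k e e', r e k → r e' k → e = e') : F.card ≤ G.card := by
  rcases F.eq_empty_or_nonempty with rfl | ⟨e0, he0⟩
  · simp
  have : Nonempty K := ⟨(h1 e0 he0).choose⟩
  choose! φ hφ using h1
  refine Finset.card_le_card_of_injOn φ (fun e he => (hφ e he).1) ?_
  intro e he e' he' hee
  refine h2 (φ e) e e' (hφ e he).2 ?_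
  have := (hφ e' he').2
  rwa [← hee] at this

variable {α β : Type*} [LinearOrder α] [LinearOrder β]

/-- Data describing how the gap above `h` formed at `v` is broken at time `z`. -/
structure AuxCore (P : α → β → Prop) (Q : β → α → Prop) (S : Finset α) (T : Finset β)
    (v : α) (h : β) (w : β) (p z : α) : Prop where
  vS : v ∈ S
  pS : p ∈ S
  zS : z ∈ S
  hT : h ∈ T
  wT : w ∈ T
  pz : p < z
  pmax : ∀ x ∈ S, x < z → x ≤ p
  vp : v ≤ p
  Pvh : P v h
  Qhv : Q h v
  last : ∀ x ∈ S, v < x → x < z → ¬ (P x h ∧ Q h x)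
  hw : h < w
  Qhp : Q h p
  Qwp : Q w p
  gap : ∀ g ∈ T, h < g → g < w → ¬ Q g p
  Qhz : Q h z

lemma AuxCore.v_eq {P : α → β → Prop} {Q : β → α → Prop} {S : Finset α} {T : Finset β}
    {v v' : α} {h w w' : β} {p p' z : α} (c : AuxCore P Q S T v h w p z)
    (c' : AuxCore P Q S T v' h w' p' z) : v = v' := by
  rcases lt_trichotomy v v' with hlt | heq | hlt
  · exact absurd ⟨c'.Pvh, c'.Qhv⟩ (c.last v' c'.vS hlt (c'.vp.trans_lt c'.pz))
  · exact heq
  · exact absurd ⟨c.Pvh, c.Qhv⟩ (c'.last v c.vS hlt (c.vp.trans_lt c.pz))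

lemma AuxCore.p_eq {P : α → β → Prop} {Q : β → α → Prop} {S : Finset α} {T : Finset β}
    {v v' : α} {h h' w w' : β} {p p' z : α} (c : AuxCore P Q S T v h w p z)
    (c' : AuxCore P Q S T v' h' w' p' z) : p = p' :=
  le_antisymm (c'.pmax p c.pS c.pz) (c.pmax p' c'.pS c'.pz)

/-- bad pairs of a planar arrangement -/
def AuxBad (P : α → β → Prop) (Q : β → α → Prop) (S : Finset α) (T : Finset β)
    (e : α × β) : Prop :=
  e.1 ∈ S ∧ e.2 ∈ T ∧ P e.1 e.2 ∧ Q e.2 e.1 ∧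
    ∃ u ∈ S, e.1 < u ∧ P u e.2 ∧ Q e.2 u ∧
      (∀ x ∈ S, e.1 < x → x < u → ¬ (P x e.2 ∧ Q e.2 x)) ∧
      (∀ w ∈ T, e.2 < w → P e.1 w → Q w e.1 → ¬ P u w)

lemma aux_break (P : α → β → Prop) (Q : β → α → Prop)
    (hP : ∀ a x y z, x ≤ y → y ≤ z → P a x → P a z → P a y)
    (hQ : ∀ b x y z, x ≤ y → y ≤ z → Q b x → Q b z → Q b y)
    (S : Finset α) (T : Finset β) (v : α) (h : β) (hb : AuxBad P Q S T (v, h)) :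
    (∀ g ∈ T, h < g → ¬ (P v g ∧ Q g v)) ∨
    ∃ w p z, AuxCore P Q S T v h w p z ∧
      (¬ Q w z ∨ (∃ g ∈ T, h < g ∧ g < w ∧ Q g z) ∨
       ((∀ g ∈ T, h < g → g < w → ¬ Q g z) ∧ Q w z ∧
        ((P z h ∧ ¬ P z w) ∨ (P z w ∧ ¬ P z h)))) := by
  classical
  obtain ⟨hvS, hhT, hPvh, hQhv, u, huS, hvu, hPuh, hQhu, hnext, hw⟩ := hb
  simp only at *
  by_cases h0 : ∀ g ∈ T, h < g → ¬ (P v g ∧ Q g v)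
  · exact Or.inl h0
  right
  push Not at h0
  obtain ⟨w0, hw0T, hw0⟩ := h0
  have hne : (T.filter (fun g => h < g ∧ P v g ∧ Q g v)).Nonempty :=
    ⟨w0, by simp [hw0T, hw0]⟩
  obtain ⟨w, hwm, hwmin⟩ := Finset.exists_min_image _ id hne
  simp only [Finset.mem_filter, id] at hwm hwmin
  obtain ⟨hwT, hhw, hPvw, hQwv⟩ := hwm
  have hgapv : ∀ g ∈ T, h < g → g < w → ¬ Q g v := by
    intro g hg h1 h2 h3
    have := hwmin g ⟨hg, h1, hP v h g w h1.le h2.le hPvh hPvw, h3⟩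
    exact absurd h2 (not_lt.mpr this)
  let idle : α → Prop := fun z =>
    Q w z ∧ (∀ g ∈ T, h < g → g < w → ¬ Q g z) ∧ ¬ P z h ∧ ¬ P z w
  have hne2 : (S.filter (fun z => v < z ∧ ¬ idle z)).Nonempty :=
    ⟨u, by simp [huS, hvu, idle, hPuh]⟩
  obtain ⟨z, hzm, hzmin⟩ := Finset.exists_min_image _ id hne2
  simp only [Finset.mem_filter, id] at hzm hzmin
  obtain ⟨hzS, hvz, hzidle⟩ := hzm
  have hzu : z ≤ u := hzmin u ⟨huS, hvu, by simp [idle, hPuh]⟩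
  have hidle : ∀ x ∈ S, v < x → x < z → idle x := by
    intro x hx h1 h2
    by_contra h3
    exact absurd h2 (not_lt.mpr (hzmin x ⟨hx, h1, h3⟩))
  have hne3 : (S.filter (fun x => x < z)).Nonempty := ⟨v, by simp [hvS, hvz]⟩
  obtain ⟨p, hpm, hpmax⟩ := Finset.exists_max_image _ id hne3
  simp only [Finset.mem_filter, id] at hpm hpmax
  obtain ⟨hpS, hpz⟩ := hpm
  have hvp : v ≤ p := hpmax v ⟨hvS, hvz⟩
  have hQhz : Q h z := hQ h v z u hvz.le hzu hQhv hQhu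
  have hpp : Q w p ∧ ∀ g ∈ T, h < g → g < w → ¬ Q g p := by
    rcases hvp.eq_or_lt with rfl | hlt
    · exact ⟨hQwv, hgapv⟩
    · have := hidle p hpS hlt hpz
      exact ⟨this.1, this.2.1⟩
  refine ⟨w, p, z, ⟨hvS, hpS, hzS, hhT, hwT, hpz, fun x hx hxz => hpmax x ⟨hx, hxz⟩, hvp, hPvh,
    hQhv, ?_, hhw, hQ h v p u hvp (hpz.le.trans hzu) hQhv hQhu, hpp.1, hpp.2, hQhz⟩, ?_⟩
  · intro x hx h1 h2 h3
    exact (hidle x hx h1 h2).2.2.1 h3.1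
  by_cases c1 : Q w z
  swap
  · exact Or.inl c1
  right
  by_cases c2 : ∃ g ∈ T, h < g ∧ g < w ∧ Q g z
  · exact Or.inl c2
  right
  have c2' : ∀ g ∈ T, h < g → g < w → ¬ Q g z := by
    intro g hg h1 h2 h3
    exact c2 ⟨g, hg, h1, h2, h3⟩
  refine ⟨c2', c1, ?_⟩
  by_cases c3 : P z h
  · left
    refine ⟨c3, fun c4 => ?_⟩
    have : z = u := by
      rcases hzu.eq_or_lt with h1 | h1
      · exact h1
      · exact absurd ⟨c3, hQhz⟩ (hnext z hzS hvz h1)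
    subst this
    exact hw w hwT hhw hPvw hQwv c4
  · right
    refine ⟨?_, c3⟩
    by_contra c4
    exact hzidle ⟨c1, c2', c3, c4⟩

lemma aux_gap_unique {T : Finset β} {A : β → Prop} {h h' k : β}
    (hh : h ∈ T) (hh' : h' ∈ T) (ah : A h) (ah' : A h') (hk : h < k) (hk' : h' < k)
    (g : ∀ g ∈ T, h < g → g < k → ¬ A g) (g' : ∀ g ∈ T, h' < g → g < k → ¬ A g) : h = h' := by
  rcases lt_trichotomy h h' with hlt | heq | hlt
  · exact absurd ah' (g h' hh' hlt hk')
  · exact heq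
  · exact absurd ah (g' h hh hlt hk)

open Classical in
lemma aux_planar (P : α → β → Prop) (Q : β → α → Prop)
    (hP : ∀ a x y z, x ≤ y → y ≤ z → P a x → P a z → P a y)
    (hQ : ∀ b x y z, x ≤ y → y ≤ z → Q b x → Q b z → Q b y)
    (S : Finset α) (T : Finset β) :
    ((S ×ˢ T).filter (AuxBad P Q S T)).card ≤ 3 * (S.card + T.card) := by
  set F := (S ×ˢ T).filter (AuxBad P Q S T) with hF
  let r1 : α × β → α → Prop := fun e k => e.1 = k ∧ e.2 ∈ T ∧ P e.1 e.2 ∧ Q e.2 e.1 ∧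
    ∀ g ∈ T, e.2 < g → ¬ (P e.1 g ∧ Q g e.1)
  let r2 : α × β → β → Prop := fun e k => ∃ p z, AuxCore P Q S T e.1 e.2 k p z ∧ ¬ Q k z
  let r3 : α × β → β → Prop := fun e k => ∃ w p z, AuxCore P Q S T e.1 e.2 w p z ∧
    e.2 < k ∧ k < w ∧ k ∈ T ∧ Q k z
  let r4 : α × β → α → Prop := fun e z => ∃ w p, AuxCore P Q S T e.1 e.2 w p z ∧
    (∀ g ∈ T, e.2 < g → g < w → ¬ Q g z) ∧ Q w z ∧ P z e.2 ∧ ¬ P z w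
  let r5 : α × β → α → Prop := fun e z => ∃ w p, AuxCore P Q S T e.1 e.2 w p z ∧
    (∀ g ∈ T, e.2 < g → g < w → ¬ Q g z) ∧ Q w z ∧ P z w ∧ ¬ P z e.2
  have cover : ∀ e ∈ F, (∃ k ∈ S, r1 e k) ∨ (∃ k ∈ T, r2 e k) ∨ (∃ k ∈ T, r3 e k) ∨
      (∃ k ∈ S, r4 e k) ∨ (∃ k ∈ S, r5 e k) := by
    rintro ⟨v, h⟩ he
    rw [hF, Finset.mem_filter] at he
    have hb := he.2
    rcases aux_break P Q hP hQ S T v h hb with h0 | ⟨w, p, z, c, h1 | ⟨g, hg, h1, h2, h3⟩ |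
      ⟨h1, h2, ⟨h3, h4⟩ | ⟨h3, h4⟩⟩⟩
    · left
      exact ⟨v, hb.1, rfl, hb.2.1, hb.2.2.1, hb.2.2.2.1, h0⟩
    · right; left
      exact ⟨w, c.wT, p, z, c, h1⟩
    · right; right; left
      exact ⟨g, hg, w, p, z, c, h1, h2, hg, h3⟩
    · right; right; right; left
      exact ⟨z, c.zS, w, p, c, h1, h2, h3, h4⟩
    · right; right; right; right
      exact ⟨z, c.zS, w, p, c, h1, h2, h3, h4⟩
  have b1 : (F.filter (fun e => ∃ k ∈ S, r1 e k)).card ≤ S.card := by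
    refine aux_card_le _ _ r1 (fun e he => (Finset.mem_filter.1 he).2) ?_
    rintro k ⟨v, h⟩ ⟨v', h'⟩ ⟨e1, m1, p1, q1, g1⟩ ⟨e2, m2, p2, q2, g2⟩
    simp only at *
    subst e1; subst e2
    rcases lt_trichotomy h h' with hlt | heq | hlt
    · exact absurd ⟨p2, q2⟩ (g1 h' m2 hlt)
    · rw [heq]
    · exact absurd ⟨p1, q1⟩ (g2 h m1 hlt)
  have b2 : (F.filter (fun e => ∃ k ∈ T, r2 e k)).card ≤ T.card := by
    refine aux_card_le _ _ r2 (fun e he => (Finset.mem_filter.1 he).2) ?_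
    rintro k ⟨v, h⟩ ⟨v', h'⟩ ⟨p, z, c, n1⟩ ⟨p', z', c', n2⟩
    simp only at *
    have hz : z = z' := by
      rcases lt_trichotomy z z' with hlt | heq | hlt
      · exact absurd (hQ k p z p' c.pz.le (c'.pmax z c.zS hlt) c.Qwp c'.Qwp) n1
      · exact heq
      · exact absurd (hQ k p' z' p c'.pz.le (c.pmax z' c'.zS hlt) c'.Qwp c.Qwp) n2
    subst hz
    have hp := c.p_eq c'
    subst hp
    have hh : h = h' :=
      aux_gap_unique (A := fun g => Q g p) c.hT c'.hT c.Qhp c'.Qhp c.hw c'.hw c.gap c'.gap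
    subst hh
    rw [c.v_eq c']
  have b3 : (F.filter (fun e => ∃ k ∈ T, r3 e k)).card ≤ T.card := by
    refine aux_card_le _ _ r3 (fun e he => (Finset.mem_filter.1 he).2) ?_
    rintro k ⟨v, h⟩ ⟨v', h'⟩ ⟨w, p, z, c, n1, n2, n3, n4⟩ ⟨w', p', z', c', n1', n2', n3', n4'⟩
    simp only at *
    have hz : z = z' := by
      rcases lt_trichotomy z z' with hlt | heq | hlt
      · exact absurd (hQ k z p' z' (c'.pmax z c.zS hlt) c'.pz.le n4 n4') (c'.gap k n3 n1' n2')
      · exact heq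
      · exact absurd (hQ k z' p z (c.pmax z' c'.zS hlt) c.pz.le n4' n4) (c.gap k n3 n1 n2)
    subst hz
    have hp := c.p_eq c'
    subst hp
    have hh : h = h' :=
      aux_gap_unique (A := fun g => Q g p) c.hT c'.hT c.Qhp c'.Qhp n1 n1'
        (fun g a b d => c.gap g a b (d.trans n2)) (fun g a b d => c'.gap g a b (d.trans n2'))
    subst hh
    rw [c.v_eq c']
  have b4 : (F.filter (fun e => ∃ k ∈ S, r4 e k)).card ≤ S.card := by
    refine aux_card_le _ _ r4 (fun e he => (Finset.mem_filter.1 he).2) ?_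
    rintro z ⟨v, h⟩ ⟨v', h'⟩ ⟨w, p, c, n1, n2, n3, n4⟩ ⟨w', p', c', n1', n2', n3', n4'⟩
    simp only at *
    have key : ∀ (v v' : α) (h h' w w' : β) (p p' : α), AuxCore P Q S T v h w p z →
        AuxCore P Q S T v' h' w' p' z → (∀ g ∈ T, h < g → g < w → ¬ Q g z) →
        P z h → ¬ P z w → P z h' → ¬ h < h' := by
      intro v v' h h' w w' p p' c c' n1 n3 n4 n3' hlt
      by_cases h1 : h' < w
      · exact n1 h' c'.hT hlt h1 c'.Qhz
      · exact n4 (hP z h w h' c.hw.le (not_lt.1 h1) n3 n3')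
    have hh : h = h' := le_antisymm
      (not_lt.1 (key _ _ _ _ _ _ _ _ c' c n1' n3' n4' n3))
      (not_lt.1 (key _ _ _ _ _ _ _ _ c c' n1 n3 n4 n3'))
    subst hh
    rw [c.v_eq c']
  have b5 : (F.filter (fun e => ∃ k ∈ S, r5 e k)).card ≤ S.card := by
    refine aux_card_le _ _ r5 (fun e he => (Finset.mem_filter.1 he).2) ?_
    rintro z ⟨v, h⟩ ⟨v', h'⟩ ⟨w, p, c, n1, n2, n3, n4⟩ ⟨w', p', c', n1', n2', n3', n4'⟩
    simp only at *
    have key : ∀ (v v' : α) (h h' w w' : β) (p p' : α), AuxCore P Q S T v h w p z →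
        AuxCore P Q S T v' h' w' p' z → (∀ g ∈ T, h < g → g < w → ¬ Q g z) →
        P z w → ¬ P z h → P z w' → Q w' z → ¬ w' < w := by
      intro v v' h h' w w' p p' c c' n1 n3 n4 n3' n2' hlt
      by_cases h1 : h < w'
      · exact n1 w' c'.wT h1 hlt n2'
      · exact n4 (hP z w' h w (not_lt.1 h1) c.hw.le n3' n3)
    have hw : w = w' := le_antisymm
      (not_lt.1 (key _ _ _ _ _ _ _ _ c c' n1 n3 n4 n3' n2'))
      (not_lt.1 (key _ _ _ _ _ _ _ _ c' c n1' n3' n4' n3 n2))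
    subst hw
    have hh : h = h' :=
      aux_gap_unique (A := fun g => Q g z) c.hT c'.hT c.Qhz c'.Qhz c.hw c'.hw n1 n1'
    subst hh
    rw [c.v_eq c']
  have hsub : F ⊆ F.filter (fun e => ∃ k ∈ S, r1 e k) ∪ (F.filter (fun e => ∃ k ∈ T, r2 e k) ∪
      (F.filter (fun e => ∃ k ∈ T, r3 e k) ∪ (F.filter (fun e => ∃ k ∈ S, r4 e k) ∪
        F.filter (fun e => ∃ k ∈ S, r5 e k)))) := by
    intro e he
    have := cover e he
    simp only [Finset.mem_union, Finset.mem_filter, he, true_and]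
    exact this
  have c0 := Finset.card_le_card hsub
  have c1 := Finset.card_union_le (F.filter (fun e => ∃ k ∈ S, r1 e k))
    (F.filter (fun e => ∃ k ∈ T, r2 e k) ∪
      (F.filter (fun e => ∃ k ∈ T, r3 e k) ∪ (F.filter (fun e => ∃ k ∈ S, r4 e k) ∪
        F.filter (fun e => ∃ k ∈ S, r5 e k))))
  have c2 := Finset.card_union_le (F.filter (fun e => ∃ k ∈ T, r2 e k))
      (F.filter (fun e => ∃ k ∈ T, r3 e k) ∪ (F.filter (fun e => ∃ k ∈ S, r4 e k) ∪
        F.filter (fun e => ∃ k ∈ S, r5 e k)))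
  have c3 := Finset.card_union_le (F.filter (fun e => ∃ k ∈ T, r3 e k))
    (F.filter (fun e => ∃ k ∈ S, r4 e k) ∪ F.filter (fun e => ∃ k ∈ S, r5 e k))
  have c4 := Finset.card_union_le (F.filter (fun e => ∃ k ∈ S, r4 e k))
    (F.filter (fun e => ∃ k ∈ S, r5 e k))
  omega

end Aux

section Aux2

lemma aux_bern (s k : ℕ) (hs : 1 ≤ s) (hk : k ≤ s) :
    (2 * s) ^ k ≤ 2 * (2 * s - 1) ^ k := by
  have hq : (0 : ℝ) < 2 * s := by positivity
  have h1 : (1 : ℝ) + k * (-(1 / (2 * s))) ≤ (1 + (-(1 / (2 * s : ℝ)))) ^ k := by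
    apply one_add_mul_le_pow
    have : (1 : ℝ) / (2 * s) ≤ 1 := by
      rw [div_le_one hq]
      have : (1 : ℝ) ≤ s := by exact_mod_cast hs
      linarith
    linarith
  have h2 : (1 : ℝ) / 2 ≤ 1 + k * (-(1 / (2 * s))) := by
    have hk' : (k : ℝ) ≤ s := by exact_mod_cast hk
    have : (k : ℝ) * (1 / (2 * s)) ≤ 1 / 2 := by
      rw [mul_one_div, div_le_div_iff₀ hq (by norm_num)]
      linarith
    linarith
  have h3 : (1 + (-(1 / (2 * s : ℝ)))) = (2 * s - 1) / (2 * s) := by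
    field_simp
    ring
  have h4 : (1 : ℝ) / 2 ≤ ((2 * s - 1) / (2 * s)) ^ k := by
    rw [← h3]; exact h2.trans h1
  rw [div_pow, le_div_iff₀ (by positivity)] at h4
  have h5 : ((2 * s : ℕ) : ℝ) ^ k ≤ 2 * ((2 * s - 1 : ℕ) : ℝ) ^ k := by
    rw [Nat.cast_sub (by omega)]
    push_cast
    linarith
  exact_mod_cast h5

lemma aux_count_eq {α : Type*} [Fintype α] [DecidableEq α] (q : ℕ) (c : Fin q) (A Z : Finset α)
    (hd : Disjoint A Z) :
    q ^ A.card * (Finset.univ.filter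
      (fun χ : α → Fin q => (∀ x ∈ A, χ x = c) ∧ ∀ x ∈ Z, χ x ≠ c)).card =
      (q - 1) ^ Z.card * q ^ (Fintype.card α - Z.card) := by
  have h1 : Finset.univ.filter
      (fun χ : α → Fin q => (∀ x ∈ A, χ x = c) ∧ ∀ x ∈ Z, χ x ≠ c) =
      Fintype.piFinset (fun x => if x ∈ A then {c} else if x ∈ Z then Finset.univ.erase c
        else Finset.univ) := by
    ext χ
    simp only [Finset.mem_filter, Finset.mem_univ, true_and, Fintype.mem_piFinset]
    constructor
    · rintro ⟨h1, h2⟩ x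
      by_cases hA : x ∈ A
      · simp [hA, h1 x hA]
      · by_cases hZ : x ∈ Z
        · simp [hA, hZ, h2 x hZ]
        · simp [hA, hZ]
    · intro h
      refine ⟨fun x hx => ?_, fun x hx => ?_⟩
      · have := h x
        simpa [hx] using this
      · have := h x
        have hA : x ∉ A := fun hA => (Finset.disjoint_left.1 hd hA hx)
        simpa [hx, hA] using this
  rw [h1, Fintype.card_piFinset]
  have h2 : q ^ A.card = ∏ x : α, if x ∈ A then q else 1 := by
    rw [Finset.prod_ite]; simp
  have h3 : (q - 1) ^ Z.card * q ^ (Fintype.card α - Z.card) =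
      ∏ x : α, if x ∈ Z then q - 1 else q := by
    rw [Finset.prod_ite]
    simp only [Finset.prod_const, Finset.filter_mem_eq_inter, Finset.univ_inter]
    congr 2
    rw [← Finset.card_compl]
    congr 1
    ext x; simp
  rw [h2, h3, ← Finset.prod_mul_distrib]
  refine Finset.prod_congr rfl fun x _ => ?_
  by_cases hA : x ∈ A
  · have hZ : x ∉ Z := fun hZ => (Finset.disjoint_left.1 hd hA hZ)
    simp [hA, hZ]
  · by_cases hZ : x ∈ Z
    · simp [hA, hZ]
    · simp [hA, hZ]

lemma aux_count_ge {α : Type*} [Fintype α] [DecidableEq α] (q s : ℕ) (hq : q = 2 * s) (hs : 1 ≤ s) (c : Fin q)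
    (A Z : Finset α) (hd : Disjoint A Z) (hZ : Z.card ≤ s) :
    q ^ Fintype.card α ≤ 2 * q ^ A.card * (Finset.univ.filter
      (fun χ : α → Fin q => (∀ x ∈ A, χ x = c) ∧ ∀ x ∈ Z, χ x ≠ c)).card := by
  subst hq
  rw [mul_assoc, aux_count_eq _ c A Z hd, ← mul_assoc]
  calc (2 * s) ^ Fintype.card α
      = (2 * s) ^ Z.card * (2 * s) ^ (Fintype.card α - Z.card) := by
        rw [← pow_add, Nat.add_sub_cancel' (Finset.card_le_univ Z)]
    _ ≤ _ := Nat.mul_le_mul_right _ (aux_bern s _ hs hZ)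

lemma aux_sum_card {α : Type*} [Fintype α] [DecidableEq α] (q : ℕ) (c : Fin q) (X : Finset α) :
    q * ∑ χ : α → Fin q, (X.filter (fun x => χ x = c)).card = X.card * q ^ Fintype.card α := by
  have h1 : ∑ χ : α → Fin q, (X.filter (fun x => χ x = c)).card =
      ∑ x ∈ X, (Finset.univ.filter (fun χ : α → Fin q => χ x = c)).card := by
    simp only [Finset.card_filter]
    rw [Finset.sum_comm]
  rw [h1, Finset.mul_sum, Finset.sum_const_nat]
  intro x _
  have := aux_count_eq q c {x} ∅ (by simp)
  simpa using this

variable {α β : Type*} [LinearOrder α] [LinearOrder β] [Fintype α] [Fintype β]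

/-- locally bad pairs -/
def AuxLoc (P : α → β → Prop) (Q : β → α → Prop) (X : Finset α) (Y : Finset β) (s t : ℕ)
    (e : α × β) : Prop :=
  P e.1 e.2 ∧ Q e.2 e.1 ∧
  ∃ (U : Finset α) (V : Finset β) (W : Finset α) (m : β),
    (∀ u ∈ U, u ∈ X ∧ e.1 < u ∧ P u e.2 ∧ Q e.2 u) ∧
    (∀ x ∈ X, e.1 < x → P x e.2 → Q e.2 x → ∀ u ∈ U, x < u → x ∈ U) ∧
    (∀ y ∈ Y, e.2 < y → P e.1 y → Q y e.1 → ∀ u ∈ V, y < u → y ∈ V) ∧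
    (∀ y ∈ V, e.2 < y) ∧
    U.card ≤ s ∧ V.card ≤ s ∧ m ∈ V ∧ W ⊆ U ∧ (∀ u ∈ W, ¬ P u m) ∧ t ≤ W.card

open Classical in
lemma aux_event (P : α → β → Prop) (Q : β → α → Prop)
    (hP : ∀ a x y z, x ≤ y → y ≤ z → P a x → P a z → P a y)
    (X : Finset α) (Y : Finset β) (q s t : ℕ) (hq : q = 2 * s) (hs : 1 ≤ s) (c : Fin q)
    (e : α × β) (heX : e.1 ∈ X) (heY : e.2 ∈ Y) (he : AuxLoc P Q X Y s t e) :
    t * (q ^ Fintype.card α * q ^ Fintype.card β) ≤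
      4 * q ^ 3 * ((Finset.univ : Finset ((α → Fin q) × (β → Fin q))).filter
        (fun ω => AuxBad P Q (X.filter (fun x => ω.1 x = c))
          (Y.filter (fun y => ω.2 y = c)) e)).card := by
  obtain ⟨v, h⟩ := e
  obtain ⟨hPvh, hQhv, U, V, W, m, hU, hUi, hVi, hV, hUs, hVs, hm, hWU, hW, ht⟩ := he
  simp only at *
  let C : α → Finset (α → Fin q) := fun u => Finset.univ.filter
      (fun χ : α → Fin q => (∀ x ∈ ({v, u} : Finset α), χ x = c) ∧ ∀ x ∈ U.erase u, χ x ≠ c)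
  let D : Finset (β → Fin q) := Finset.univ.filter
      (fun χ : β → Fin q => (∀ x ∈ ({h} : Finset β), χ x = c) ∧ ∀ x ∈ V, χ x ≠ c)
  have hC : ∀ u ∈ W, q ^ Fintype.card α ≤ 2 * q ^ 2 * (C u).card := by
    intro u hu
    have hvu := (hU u (hWU hu)).2.1
    have := aux_count_ge q s hq hs c {v, u} (U.erase u) (by
      rw [Finset.disjoint_left]
      intro x hx
      simp only [Finset.mem_insert, Finset.mem_singleton] at hx
      rcases hx with rfl | rfl
      · intro h'
        exact lt_irrefl _ (hU _ (Finset.mem_of_mem_erase h')).2.1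
      · simp) ((Finset.card_erase_le).trans hUs)
    rw [Finset.card_pair hvu.ne] at this
    exact this
  have hD : q ^ Fintype.card β ≤ 2 * q ^ 1 * D.card := by
    have := aux_count_ge q s hq hs c {h} V (by
      rw [Finset.disjoint_left]
      intro x hx hx'
      simp only [Finset.mem_singleton] at hx
      subst hx
      exact lt_irrefl _ (hV _ hx')) hVs
    rw [Finset.card_singleton] at this
    exact this
  have hdisj : ∀ u ∈ W, ∀ u' ∈ W, u ≠ u' → Disjoint (C u) (C u') := by
    intro u hu u' hu' hne
    rw [Finset.disjoint_left]
    intro χ h1 h2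
    simp only [C, Finset.mem_filter, Finset.mem_univ, true_and] at h1 h2
    exact h2.2 u (Finset.mem_erase.2 ⟨hne, hWU hu⟩) (h1.1 u (by simp))
  have hbi : t * q ^ Fintype.card α ≤ 2 * q ^ 2 * (W.biUnion C).card := by
    rw [Finset.card_biUnion hdisj, Finset.mul_sum]
    calc t * q ^ Fintype.card α ≤ W.card * q ^ Fintype.card α := Nat.mul_le_mul_right _ ht
      _ = ∑ u ∈ W, q ^ Fintype.card α := by simp
      _ ≤ _ := Finset.sum_le_sum hC
  have hsub : (W.biUnion C) ×ˢ D ⊆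
      (Finset.univ : Finset ((α → Fin q) × (β → Fin q))).filter
        (fun ω => AuxBad P Q (X.filter (fun x => ω.1 x = c))
          (Y.filter (fun y => ω.2 y = c)) (v, h)) := by
    rintro ⟨χ, ψ⟩ hω
    simp only [Finset.mem_product, Finset.mem_biUnion, C, D, Finset.mem_filter, Finset.mem_univ,
      true_and, Finset.mem_singleton, forall_eq, Finset.mem_insert, forall_eq_or_imp,
      Finset.mem_erase, and_imp] at hω
    obtain ⟨⟨u, huW, ⟨hχv, hχu⟩, hχU⟩, hψh, hψV⟩ := hω
    obtain ⟨huX, hvu, hPuh, hQhu⟩ := hU u (hWU huW)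
    simp only [Finset.mem_filter, Finset.mem_univ, true_and]
    refine ⟨by simp [heX, hχv], by simp [heY, hψh], hPvh, hQhv, u, by simp [huX, hχu], hvu, hPuh,
      hQhu, ?_, ?_⟩
    · intro x hx h1 h2 h3
      simp only [Finset.mem_filter] at hx
      exact hχU x h2.ne (hUi x hx.1 h1 h3.1 h3.2 u (hWU huW) h2) hx.2
    · intro w hw h1 h2 h3 h4
      simp only [Finset.mem_filter] at hw
      have hmw : m ≤ w := by
        by_contra hlt
        exact hψV w (hVi w hw.1 h1 h2 h3 m hm (not_le.1 hlt)) hw.2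
      exact hW u huW (hP u h m w (hV m hm).le hmw hPuh h4)
  have hcard := Finset.card_le_card hsub
  rw [Finset.card_product] at hcard
  calc t * (q ^ Fintype.card α * q ^ Fintype.card β)
      = (t * q ^ Fintype.card α) * q ^ Fintype.card β := by ring
    _ ≤ (2 * q ^ 2 * (W.biUnion C).card) * (2 * q ^ 1 * D.card) := Nat.mul_le_mul hbi hD
    _ = 4 * q ^ 3 * ((W.biUnion C).card * D.card) := by ring
    _ ≤ _ := Nat.mul_le_mul_left _ hcard

open Classical in
lemma aux_local (P : α → β → Prop) (Q : β → α → Prop)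
    (hP : ∀ a x y z, x ≤ y → y ≤ z → P a x → P a z → P a y)
    (hQ : ∀ b x y z, x ≤ y → y ≤ z → Q b x → Q b z → Q b y)
    (X : Finset α) (Y : Finset β) (s t : ℕ) (hs : 1 ≤ s) :
    t * ((X ×ˢ Y).filter (AuxLoc P Q X Y s t)).card ≤ 48 * s ^ 2 * (X.card + Y.card) := by
  set q := 2 * s with hq
  have hq0 : 0 < q := by omega
  let c : Fin q := ⟨0, hq0⟩
  set G := (X ×ˢ Y).filter (AuxLoc P Q X Y s t) with hG
  let bad : (α → Fin q) × (β → Fin q) → α × β → Prop := fun ω e =>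
    AuxBad P Q (X.filter (fun x => ω.1 x = c)) (Y.filter (fun y => ω.2 y = c)) e
  set N := q ^ Fintype.card α * q ^ Fintype.card β with hN
  have hN0 : 0 < N := by positivity
  have h1 : G.card * (t * N) ≤ ∑ e ∈ G, 4 * q ^ 3 *
      ((Finset.univ : Finset ((α → Fin q) × (β → Fin q))).filter (fun ω => bad ω e)).card := by
    rw [← smul_eq_mul, ← Finset.sum_const]
    refine Finset.sum_le_sum fun e he => ?_
    rw [hG, Finset.mem_filter, Finset.mem_product] at he
    exact aux_event P Q hP X Y q s t hq hs c e he.1.1 he.1.2 he.2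
  have h2 : ∑ e ∈ G, ((Finset.univ : Finset ((α → Fin q) × (β → Fin q))).filter
      (fun ω => bad ω e)).card = ∑ ω : (α → Fin q) × (β → Fin q), (G.filter (bad ω)).card := by
    simp only [Finset.card_filter]
    rw [Finset.sum_comm]
  have h3 : ∀ ω : (α → Fin q) × (β → Fin q), (G.filter (bad ω)).card ≤
      3 * ((X.filter (fun x => ω.1 x = c)).card + (Y.filter (fun y => ω.2 y = c)).card) := by
    intro ω
    refine le_trans (Finset.card_le_card ?_) (aux_planar P Q hP hQ _ _)
    intro e he
    have hb := (Finset.mem_filter.1 he).2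
    rw [Finset.mem_filter, Finset.mem_product]
    exact ⟨⟨hb.1, hb.2.1⟩, hb⟩
  have h4 : q * ∑ ω : (α → Fin q) × (β → Fin q),
      ((X.filter (fun x => ω.1 x = c)).card + (Y.filter (fun y => ω.2 y = c)).card) =
      (X.card + Y.card) * N := by
    rw [Fintype.sum_prod_type]
    simp only [Finset.sum_add_distrib, Finset.sum_const, smul_eq_mul, Finset.card_univ]
    rw [← Finset.mul_sum, mul_add]
    have e1 := aux_sum_card q c X
    have e2 := aux_sum_card q c Y
    simp only [Fintype.card_fun, Fintype.card_fin] 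
    calc _ = q ^ Fintype.card β * (q * ∑ χ : α → Fin q, (X.filter (fun x => χ x = c)).card) +
          q ^ Fintype.card α * (q * ∑ χ : β → Fin q, (Y.filter (fun x => χ x = c)).card) := by ring
      _ = _ := by rw [e1, e2, hN]; ring
  have h5 : (t * G.card) * N ≤ (48 * s ^ 2 * (X.card + Y.card)) * N := by
    calc (t * G.card) * N = G.card * (t * N) := by ring
      _ ≤ _ := h1
      _ = 4 * q ^ 3 * ∑ ω : (α → Fin q) × (β → Fin q), (G.filter (bad ω)).card := by
        rw [← Finset.mul_sum, h2]
      _ ≤ 4 * q ^ 3 * ∑ ω : (α → Fin q) × (β → Fin q),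
          3 * ((X.filter (fun x => ω.1 x = c)).card + (Y.filter (fun y => ω.2 y = c)).card) :=
        Nat.mul_le_mul_left _ (Finset.sum_le_sum fun ω _ => h3 ω)
      _ = 12 * q ^ 2 * (q * ∑ ω : (α → Fin q) × (β → Fin q),
          ((X.filter (fun x => ω.1 x = c)).card + (Y.filter (fun y => ω.2 y = c)).card)) := by
        rw [← Finset.mul_sum]; ring
      _ = _ := by rw [h4, hq]; ring
  exact Nat.le_of_mul_le_mul_right h5 hN0

end Aux2

section Aux3

lemma aux_initial {α : Type*} [LinearOrder α] (N : Finset α) (s : ℕ) (hs : s ≤ N.card) :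
    ∃ U ⊆ N, U.card = s ∧ ∀ x ∈ N, ∀ u ∈ U, x < u → x ∈ U := by
  induction s with
  | zero => exact ⟨∅, by simp, by simp, by simp⟩
  | succ s ih =>
    obtain ⟨U, hUN, hUc, hUi⟩ := ih (by omega)
    have hne : (N \ U).Nonempty := by
      rw [← Finset.card_pos, Finset.card_sdiff_of_subset hUN]
      omega
    obtain ⟨m, hm, hmin⟩ := Finset.exists_min_image _ id hne
    simp only [Finset.mem_sdiff, id, and_imp] at hm hmin
    refine ⟨insert m U, ?_, ?_, ?_⟩
    · intro x hx
      rcases Finset.mem_insert.1 hx with rfl | hx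
      · exact hm.1
      · exact hUN hx
    · rw [Finset.card_insert_of_notMem hm.2, hUc]
    · intro x hx u hu hxu
      rcases Finset.mem_insert.1 hu with rfl | hu
      · by_contra hxU
        have hxU' : x ∉ U := fun h => hxU (Finset.mem_insert_of_mem h)
        exact absurd hxu (not_lt.2 (hmin x hx hxU'))
      · exact Finset.mem_insert_of_mem (hUi x hx u hu hxu)

variable {d : ℕ} {V : Fin d → Type} [∀ i, Fintype (V i)] [∀ i, LinearOrder (V i)]

/-- hyperedges as cliques -/
def AuxH (R : ∀ i j, V i → V j → Prop) (f : ∀ i, V i) : Prop :=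
  ∀ i j, i ≠ j → R i j (f i) (f j)

/-- `x` is a possible upper replacement of `f i` -/
def AuxN (R : ∀ i j, V i → V j → Prop) (f : ∀ i, V i) (i : Fin d) (x : V i) : Prop :=
  f i < x ∧ ∀ k, k ≠ i → R i k x (f k) ∧ R k i (f k) x

/-- locally bad hyperedges with respect to the pair `i`, `j` -/
def AuxB (R : ∀ i j, V i → V j → Prop) (s t : ℕ) (i j : Fin d) (f : ∀ i, V i) : Prop :=
  i ≠ j ∧ AuxH R f ∧
  ∃ (U : Finset (V i)) (W : Finset (V j)) (Z : Finset (V i)) (m : V j),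
    (∀ u ∈ U, AuxN R f i u) ∧
    (∀ x, AuxN R f i x → ∀ u ∈ U, x < u → x ∈ U) ∧
    (∀ y, AuxN R f j y → ∀ u ∈ W, y < u → y ∈ W) ∧
    (∀ y ∈ W, f j < y) ∧
    U.card ≤ s ∧ W.card ≤ s ∧ m ∈ W ∧ Z ⊆ U ∧ (∀ u ∈ Z, ¬ R i j u m) ∧ t ≤ Z.card

open Classical in
lemma aux_pair (R : ∀ i j, V i → V j → Prop)
    (hR : ∀ i j, i ≠ j → ∀ a x y z, x ≤ y → y ≤ z → R i j a x → R i j a z → R i j a y)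
    (s t : ℕ) (hs : 1 ≤ s) (i j : Fin d) :
    t * (Finset.univ.filter (AuxB R s t i j)).card ≤
      48 * s ^ 2 * (∏ k ∈ Finset.univ.erase i, Fintype.card (V k) +
        ∏ k ∈ Finset.univ.erase j, Fintype.card (V k)) := by
  by_cases hij : i = j
  · have : Finset.univ.filter (AuxB R s t i j) = ∅ := by
      ext f
      simp [AuxB, hij]
    rw [this]; simp
  let ρ : (∀ k, V k) → (∀ k : {k // k ≠ i ∧ k ≠ j}, V k) := fun f k => f k
  set F := Finset.univ.filter (AuxB R s t i j) with hF
  have hfib : ∀ r : (∀ k : {k // k ≠ i ∧ k ≠ j}, V k),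
      t * (F.filter (fun f => ρ f = r)).card ≤
        48 * s ^ 2 * (Fintype.card (V i) + Fintype.card (V j)) := by
    intro r
    rcases (F.filter (fun f => ρ f = r)).eq_empty_or_nonempty with h0 | ⟨f0, hf0⟩
    · rw [h0]; simp
    have hf0r := (Finset.mem_filter.1 hf0).2
    let X : Finset (V i) := Finset.univ.filter
      (fun x => ∀ k, k ≠ i → k ≠ j → R i k x (f0 k) ∧ R k i (f0 k) x)
    let Y : Finset (V j) := Finset.univ.filter
      (fun x => ∀ k, k ≠ i → k ≠ j → R j k x (f0 k) ∧ R k j (f0 k) x)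
    have hloc := aux_local (R i j) (R j i) (hR i j hij) (hR j i (Ne.symm hij)) X Y s t hs
    have hcard : (F.filter (fun f => ρ f = r)).card ≤
        ((X ×ˢ Y).filter (AuxLoc (R i j) (R j i) X Y s t)).card := by
      have same : ∀ f, ρ f = r → ∀ k, k ≠ i → k ≠ j → f k = f0 k := by
        intro f hf k h1 h2
        have := congrFun (hf.trans hf0r.symm) ⟨k, h1, h2⟩
        exact this
      refine Finset.card_le_card_of_injOn (fun f => (f i, f j)) ?_ ?_
      · intro f hf
        rw [Finset.mem_coe, Finset.mem_filter] at hf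
        obtain ⟨hfF, hfr⟩ := hf
        obtain ⟨-, hH, U, W, Z, m, hU, hUi, hWi, hW, h1, h2, h3, h4, h5, h6⟩ :=
          (Finset.mem_filter.1 hfF).2
        have sm := same f hfr
        rw [Finset.mem_coe, Finset.mem_filter, Finset.mem_product]
        refine ⟨⟨?_, ?_⟩, hH i j hij, hH j i (Ne.symm hij), U, W, Z, m, ?_, ?_, ?_, hW,
          h1, h2, h3, h4, h5, h6⟩
        · simp only [X, Finset.mem_filter, Finset.mem_univ, true_and]
          intro k hki hkj
          rw [← sm k hki hkj]
          exact ⟨hH i k (Ne.symm hki), hH k i hki⟩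
        · simp only [Y, Finset.mem_filter, Finset.mem_univ, true_and]
          intro k hki hkj
          rw [← sm k hki hkj]
          exact ⟨hH j k (Ne.symm hkj), hH k j hkj⟩
        · intro u hu
          obtain ⟨a1, a2⟩ := hU u hu
          refine ⟨?_, a1, a2 j (Ne.symm hij)⟩
          simp only [X, Finset.mem_filter, Finset.mem_univ, true_and]
          intro k hki hkj
          rw [← sm k hki hkj]
          exact a2 k hki
        · intro x hx b1 b2 b3
          refine hUi x ⟨b1, fun k hk => ?_⟩
          by_cases hkj : k = j
          · subst hkj
            exact ⟨b2, b3⟩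
          · rw [sm k hk hkj]
            exact (Finset.mem_filter.1 hx).2 k hk hkj
        · intro x hx b1 b2 b3
          refine hWi x ⟨b1, fun k hk => ?_⟩
          by_cases hki : k = i
          · subst hki
            exact ⟨b3, b2⟩
          · rw [sm k hki hk]
            exact (Finset.mem_filter.1 hx).2 k hki hk
      · intro f hf g hg hfg
        rw [Finset.mem_coe, Finset.mem_filter] at hf hg
        simp only [Prod.mk.injEq] at hfg
        funext k
        by_cases hki : k = i
        · subst hki; exact hfg.1
        by_cases hkj : k = j
        · subst hkj; exact hfg.2
        rw [same f hf.2 k hki hkj, same g hg.2 k hki hkj]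
    calc _ ≤ t * _ := Nat.mul_le_mul_left _ hcard
      _ ≤ _ := hloc
      _ ≤ _ := Nat.mul_le_mul_left _ (add_le_add (Finset.card_le_univ _) (Finset.card_le_univ _))
  have hsum : F.card = ∑ r : (∀ k : {k // k ≠ i ∧ k ≠ j}, V k),
      (F.filter (fun f => ρ f = r)).card :=
    Finset.card_eq_sum_card_fiberwise (fun _ _ => Finset.mem_coe.2 (Finset.mem_univ _))
  have hc1 : Fintype.card (∀ k : {k // k ≠ i ∧ k ≠ j}, V k) =
      ∏ k ∈ (Finset.univ.erase j).erase i, Fintype.card (V k) := by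
    rw [Fintype.card_pi]
    exact (Finset.prod_subtype _ (by intro x; simp [and_comm]) (fun k => Fintype.card (V k))).symm
  have hc2 : Fintype.card (V i) * ∏ k ∈ (Finset.univ.erase j).erase i, Fintype.card (V k) =
      ∏ k ∈ Finset.univ.erase j, Fintype.card (V k) :=
    Finset.mul_prod_erase _ (fun k => Fintype.card (V k)) (by simp [hij])
  have hc3 : Fintype.card (V j) * ∏ k ∈ (Finset.univ.erase j).erase i, Fintype.card (V k) =
      ∏ k ∈ Finset.univ.erase i, Fintype.card (V k) := by
    rw [Finset.erase_right_comm]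
    exact Finset.mul_prod_erase _ (fun k => Fintype.card (V k)) (by simp [Ne.symm hij])
  rw [hsum, Finset.mul_sum]
  calc _ ≤ ∑ r : (∀ k : {k // k ≠ i ∧ k ≠ j}, V k),
        48 * s ^ 2 * (Fintype.card (V i) + Fintype.card (V j)) :=
        Finset.sum_le_sum fun r _ => hfib r
    _ = 48 * s ^ 2 * (Fintype.card (V j) * Fintype.card (∀ k : {k // k ≠ i ∧ k ≠ j}, V k) +
        Fintype.card (V i) * Fintype.card (∀ k : {k // k ≠ i ∧ k ≠ j}, V k)) := by
        rw [Finset.sum_const, smul_eq_mul, Finset.card_univ]; ring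
    _ = _ := by rw [hc1, hc2, hc3]

open Classical in
lemma aux_last (R : ∀ i j, V i → V j → Prop) (s : ℕ) (i : Fin d) :
    (Finset.univ.filter (fun f : ∀ k, V k => AuxH R f ∧
      (Finset.univ.filter (AuxN R f i)).card < s)).card ≤
      s * ∏ k ∈ Finset.univ.erase i, Fintype.card (V k) := by
  let ρ : (∀ k, V k) → (∀ k : {k // k ≠ i}, V k) := fun f k => f k
  set F := Finset.univ.filter (fun f : ∀ k, V k => AuxH R f ∧
      (Finset.univ.filter (AuxN R f i)).card < s) with hF
  have hfib : ∀ r : (∀ k : {k // k ≠ i}, V k), (F.filter (fun f => ρ f = r)).card ≤ s := by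
    intro r
    rcases (F.filter (fun f => ρ f = r)).eq_empty_or_nonempty with h0 | hne
    · rw [h0]; simp
    obtain ⟨f0, hf0, hmin⟩ := Finset.exists_min_image _ (fun f => f i) hne
    rw [Finset.mem_filter] at hf0
    have hs0 := (Finset.mem_filter.1 hf0.1).2.2
    have hcard : (F.filter (fun f => ρ f = r)).card ≤
        (insert (f0 i) (Finset.univ.filter (AuxN R f0 i))).card := by
      have same : ∀ f, ρ f = r → ∀ k, k ≠ i → f k = f0 k := by
        intro f hf k h1
        exact congrFun (hf.trans hf0.2.symm) ⟨k, h1⟩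
      refine Finset.card_le_card_of_injOn (fun f => f i) ?_ ?_
      · intro f hf
        rw [Finset.mem_coe] at hf
        have hle := hmin f hf
        rw [Finset.mem_filter] at hf
        have hH := (Finset.mem_filter.1 hf.1).2.1
        rw [Finset.mem_coe, Finset.mem_insert]
        rcases hle.eq_or_lt with h1 | h1
        · exact Or.inl h1.symm
        · right
          simp only [Finset.mem_filter, Finset.mem_univ, true_and]
          refine ⟨h1, fun k hk => ?_⟩
          rw [← same f hf.2 k hk]
          exact ⟨hH i k (Ne.symm hk), hH k i hk⟩
      · intro f hf g hg hfg
        rw [Finset.mem_coe, Finset.mem_filter] at hf hg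
        funext k
        by_cases hki : k = i
        · subst hki; exact hfg
        rw [same f hf.2 k hki, same g hg.2 k hki]
    have := Finset.card_insert_le (f0 i) (Finset.univ.filter (AuxN R f0 i))
    omega
  have hsum : F.card = ∑ r : (∀ k : {k // k ≠ i}, V k), (F.filter (fun f => ρ f = r)).card :=
    Finset.card_eq_sum_card_fiberwise (fun _ _ => Finset.mem_coe.2 (Finset.mem_univ _))
  have hc1 : Fintype.card (∀ k : {k // k ≠ i}, V k) =
      ∏ k ∈ Finset.univ.erase i, Fintype.card (V k) := by
    rw [Fintype.card_pi]
    exact (Finset.prod_subtype _ (by intro x; simp [and_comm]) (fun k => Fintype.card (V k))).symm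
  rw [hsum]
  calc _ ≤ ∑ r : (∀ k : {k // k ≠ i}, V k), s := Finset.sum_le_sum fun r _ => hfib r
    _ = _ := by rw [Finset.sum_const, smul_eq_mul, Finset.card_univ, hc1, mul_comm]

open Classical in
lemma aux_good (R : ∀ i j, V i → V j → Prop)
    (hR : ∀ i j, i ≠ j → ∀ a x y z, x ≤ y → y ≤ z → R i j a x → R i j a z → R i j a y)
    (t : ℕ) (ht : 1 ≤ t) (f : ∀ i, V i) (hf : AuxH R f)
    (h1 : ∀ i, ¬ (Finset.univ.filter (AuxN R f i)).card < d * t)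
    (h2 : ∀ i j, ¬ AuxB R (d * t) t i j f) :
    ∃ S : ∀ i, Finset (V i), (∀ i, (S i).card = t) ∧
      ∀ g : ∀ i, V i, (∀ i, g i ∈ S i) → AuxH R g := by
  have hU : ∀ i, ∃ U ⊆ Finset.univ.filter (AuxN R f i), U.card = d * t ∧
      ∀ x ∈ Finset.univ.filter (AuxN R f i), ∀ u ∈ U, x < u → x ∈ U :=
    fun i => aux_initial _ _ (not_lt.1 (h1 i))
  choose U hUN hUc hUi using hU
  have hm : ∀ i, ∃ m ∈ U i, ∀ u ∈ U i, u ≤ m := by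
    intro i
    have hne : (U i).Nonempty := by
      rw [← Finset.card_pos, hUc]
      have := i.pos
      positivity
    exact Finset.exists_max_image _ id hne
  choose m hmU hmax using hm
  have hN : ∀ i, ∀ u ∈ U i, AuxN R f i u := fun i u hu => (Finset.mem_filter.1 (hUN i hu)).2
  have hW : ∀ i j, i ≠ j → ((U i).filter (fun u => ¬ R i j u (m j))).card ≤ t := by
    intro i j hij
    by_contra hlt
    refine h2 i j ⟨hij, hf, U i, U j, (U i).filter (fun u => ¬ R i j u (m j)), m j, hN i, ?_, ?_,
      fun y hy => (hN j y hy).1, (hUc i).le, (hUc j).le, hmU j, Finset.filter_subset _ _,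
      fun u hu => (Finset.mem_filter.1 hu).2, (not_le.1 hlt).le⟩
    · intro x hx
      exact hUi i x (by simp [hx])
    · intro x hx
      exact hUi j x (by simp [hx])
  have hS : ∀ i, ∃ S ⊆ (U i) \ ((Finset.univ.erase i).biUnion
      (fun j => (U i).filter (fun u => ¬ R i j u (m j)))), S.card = t := by
    intro i
    apply Finset.exists_subset_card_eq
    have e1 := Finset.card_biUnion_le_card_mul (Finset.univ.erase i)
      (fun j => (U i).filter (fun u => ¬ R i j u (m j))) t (fun j hj =>
        hW i j (Ne.symm (Finset.ne_of_mem_erase hj)))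
    have e2 := Finset.le_card_sdiff ((Finset.univ.erase i).biUnion
      (fun j => (U i).filter (fun u => ¬ R i j u (m j)))) (U i)
    rw [Finset.card_erase_of_mem (Finset.mem_univ _), Finset.card_univ, Fintype.card_fin] at e1
    rw [hUc] at e2
    have e3 : d * t = (d - 1) * t + t := by
      have := i.pos
      obtain ⟨e, rfl⟩ : ∃ e, d = e + 1 := ⟨d - 1, by omega⟩
      rw [Nat.add_sub_cancel]; ring
    omega
  choose S hSU hSc using hS
  refine ⟨S, hSc, fun g hg i j hij => ?_⟩
  have gi := Finset.mem_sdiff.1 (hSU i (hg i))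
  have gj := Finset.mem_sdiff.1 (hSU j (hg j))
  have r1 : R i j (g i) (f j) := ((hN i _ gi.1).2 j (Ne.symm hij)).1
  have r2 : R i j (g i) (m j) := by
    by_contra hn
    refine gi.2 (Finset.mem_biUnion.2 ⟨j, ?_, Finset.mem_filter.2 ⟨gi.1, hn⟩⟩)
    simp [Ne.symm hij]
  exact hR i j hij (g i) (f j) (g j) (m j) (hN j _ gj.1).1.le (hmax j _ gj.1) r1 r2

open Classical in
lemma aux_core (R : ∀ i j, V i → V j → Prop)
    (hR : ∀ i j, i ≠ j → ∀ a x y z, x ≤ y → y ≤ z → R i j a x → R i j a z → R i j a y)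
    (t : ℕ) (ht : 1 ≤ t)
    (hfree : ¬ ∃ S : ∀ i, Finset (V i), (∀ i, (S i).card = t) ∧
      ∀ g : ∀ i, V i, (∀ i, g i ∈ S i) → AuxH R g) :
    (Finset.univ.filter (AuxH R)).card ≤
      (d ^ 2 + 96 * d ^ 4) * (t * ∑ i, ∏ k ∈ Finset.univ.erase i, Fintype.card (V k)) := by
  rcases Nat.eq_zero_or_pos d with rfl | hd
  · exfalso
    exact hfree ⟨fun i => i.elim0, fun i => i.elim0, fun g _ i => i.elim0⟩
  set D := ∑ i, ∏ k ∈ Finset.univ.erase i, Fintype.card (V k) with hD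
  have hDi : ∀ i, ∏ k ∈ Finset.univ.erase i, Fintype.card (V k) ≤ D := fun i =>
    Finset.single_le_sum (f := fun i => ∏ k ∈ Finset.univ.erase i, Fintype.card (V k))
      (fun _ _ => Nat.zero_le _) (Finset.mem_univ i)
  let A : Fin d → Finset (∀ k, V k) := fun i => Finset.univ.filter (fun f : ∀ k, V k => AuxH R f ∧
      (Finset.univ.filter (AuxN R f i)).card < d * t)
  let B : Fin d × Fin d → Finset (∀ k, V k) := fun p =>
    Finset.univ.filter (AuxB R (d * t) t p.1 p.2)
  have hs : 1 ≤ d * t := Nat.mul_pos hd ht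
  have hA : ∀ i, (A i).card ≤ d * t * D := fun i =>
    (aux_last R (d * t) i).trans (Nat.mul_le_mul_left _ (hDi i))
  have hB : ∀ p, (B p).card ≤ 96 * d ^ 2 * t * D := by
    intro p
    have h1 := aux_pair R hR (d * t) t hs p.1 p.2
    refine le_of_mul_le_mul_left (a := t) (h1.trans ?_) ht
    calc _ ≤ 48 * (d * t) ^ 2 * (D + D) := Nat.mul_le_mul_left _ (add_le_add (hDi _) (hDi _))
      _ = _ := by ring
  have hsub : Finset.univ.filter (AuxH R) ⊆ Finset.univ.biUnion A ∪ Finset.univ.biUnion B := by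
    intro f hf
    have hf' := (Finset.mem_filter.1 hf).2
    by_contra hn
    rw [Finset.mem_union, not_or] at hn
    refine hfree (aux_good R hR t ht f hf' (fun i hi => ?_) (fun i j hij => ?_))
    · exact hn.1 (Finset.mem_biUnion.2 ⟨i, Finset.mem_univ _, Finset.mem_filter.2
        ⟨Finset.mem_univ _, hf', hi⟩⟩)
    · exact hn.2 (Finset.mem_biUnion.2 ⟨(i, j), Finset.mem_univ _, Finset.mem_filter.2
        ⟨Finset.mem_univ _, hij⟩⟩)
  have c1 := Finset.card_biUnion_le_card_mul Finset.univ A _ (fun i _ => hA i)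
  have c2 := Finset.card_biUnion_le_card_mul Finset.univ B _ (fun i _ => hB i)
  simp only [Finset.card_univ, Fintype.card_prod, Fintype.card_fin] at c1 c2
  calc _ ≤ _ := Finset.card_le_card hsub
    _ ≤ _ := Finset.card_union_le _ _
    _ ≤ _ := add_le_add c1 c2
    _ = _ := by ring

end Aux3

/-- the separated case, `e(H) ≤ M_d · g_t(n_1,…,n_d)`. -/
theorem stmt8 (d : ℕ) (hd : 2 ≤ d) :
    ∃ M : ℝ, 0 < M ∧
      ∀ (t : ℕ), 2 ≤ t →
      ∀ (n : Fin d → ℕ), (∀ i, 0 < n i) →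
      ∀ (B : ∀ i : Fin d, Fin (n i) → Set (Fin d → ℝ)),
        Separated n B → KFree t n B →
        (hyperedgeCount n B : ℝ) ≤ M * gZ t n := by
  classical
  refine ⟨((d ^ 2 + 96 * d ^ 4 : ℕ) : ℝ), by positivity, ?_⟩
  intro t ht n hn B hsep hfree
  obtain ⟨hcan, hinj⟩ := hsep
  choose lo hi hle hB hdir using hcan
  have hlohi : ∀ i k, lo i k i = hi i k i := by
    intro i k
    have h1 : i ∉ {j | j ≠ i} := by simp
    rw [hdir i k] at h1
    exact le_antisymm (hle i k i) (not_lt.1 h1)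
  let c : ∀ i, Fin (n i) → ℝ := fun i k => lo i k i
  have hcinj : ∀ i, Function.Injective (c i) := by
    intro i k l hkl
    by_contra hne
    refine hinj i k l hne (lo i k) ?_ (lo i l) ?_ hkl
    · rw [hB]; exact fun j => ⟨le_rfl, hle i k j⟩
    · rw [hB]; exact fun j => ⟨le_rfl, hle i l j⟩
  let R : ∀ i j, Fin (n i) → Fin (n j) → Prop := fun i j a b =>
    c j b ∈ Set.Icc (lo i a j) (hi i a j)
  have hedge : ∀ f : ∀ j : Fin d, Fin (n j), (⋂ j, B j (f j)).Nonempty ↔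
      AuxH (V := fun i => Fin (n i)) R f := by
    intro f
    constructor
    · rintro ⟨x, hx⟩ i j hij
      rw [Set.mem_iInter] at hx
      have hxi := hx i
      have hxj := hx j
      rw [hB] at hxi hxj
      have e : x j = c j (f j) := by
        have := hxj j
        rw [← hlohi] at this
        exact le_antisymm this.2 this.1
      have := hxi j
      rw [e] at this
      exact this
    · intro h
      refine ⟨fun j => c j (f j), Set.mem_iInter.2 fun i => ?_⟩
      rw [hB]
      intro j
      by_cases hij : i = j
      · subst hij
        exact ⟨le_rfl, hle _ _ _⟩
      · exact h i j hij
  have hcore := @aux_core d (fun i => Fin (n i)) _ (fun i => LinearOrder.lift' (c i) (hcinj i)) R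
    (by
      intro i j _ a x y z hxy hyz h1 h2
      have hxy' : c j x ≤ c j y := hxy
      have hyz' : c j y ≤ c j z := hyz
      exact ⟨h1.1.trans hxy', hyz'.trans h2.2⟩) t (by omega)
    (by
      rintro ⟨S, hS1, hS2⟩
      exact hfree ⟨S, hS1, fun f hf => (hedge f).2 (hS2 f hf)⟩)
  have hcount : hyperedgeCount n B = (Finset.univ.filter
      (AuxH (V := fun i => Fin (n i)) R)).card := by
    unfold hyperedgeCount
    rw [Nat.card_eq_fintype_card, Fintype.card_subtype]
    congr 1
    ext f
    rw [Finset.mem_filter, Finset.mem_filter, hedge f]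
  have hg : gZ t n = ((t * ∑ i, ∏ k ∈ Finset.univ.erase i, Fintype.card (Fin (n k)) : ℕ) : ℝ) := by
    unfold gZ
    push_cast
    rw [mul_assoc, Finset.mul_sum]
    congr 1
    refine Finset.sum_congr rfl fun i _ => ?_
    rw [← Finset.mul_prod_erase _ (fun k => (n k : ℝ)) (Finset.mem_univ i)]
    have : (n i : ℝ) ≠ 0 := by exact_mod_cast (hn i).ne'
    simp only [Fintype.card_fin]
    field_simp
  rw [hg, ← Nat.cast_mul, Nat.cast_le, hcount]
  convert hcore
end
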